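/- arXiv:1509.02023 — 11 statements merged into one kernel-verified Lean document; each statement's English description precedes it below -/
import Mathlib

section
/- Let X = {x_1, …, x_n} ⊂ ℝ^d, let 2 ≤ p < ∞, let γ = max_{i} ‖x_i‖_p, let λ > 0, and let f : conv(X) → ℝ be λ-Lipschitz with respect to the L_p norm (i.e. |f(u) − f(v)| ≤ λ·‖u − v‖_p for all u, v ∈ conv(X)). Let x* ∈ conv(X) be a maximizer of f over conv(X). Then for every ε > 0 and every positive integer k ≥ 4λ²pγ²/ε², there exists a k-uniform point x' ∈ conv(X) such that |f(x*) − f(x')| ≤ ε. -/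
open Finset

/-- The `L_p` norm of a vector in `ℝ^d` (for a real exponent `p`). -/
noncomputable def lpNorm {d : ℕ} (p : ℝ) (x : Fin d → ℝ) : ℝ :=
  (∑ i, |x i| ^ p) ^ (1 / p)

/-- Since `artanh` is superlinear on `[0, 1)`, one has `r * artanh x ≤ artanh (r * x)`; this is the
exponential form of that inequality, and the case `1 ≤ r * x` is included. -/
theorem one_sub_mul_rpow_le {r x : ℝ} (hr : 1 ≤ r) (hx0 : 0 ≤ x) (hx1 : x < 1) :
    (1 - r * x) * (1 + x) ^ r ≤ (1 + r * x) * (1 - x) ^ r := by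
  have hr0 : 0 ≤ r := by linarith
  have hrx0 : 0 ≤ r * x := by positivity
  have hA : 0 < (1 + x) ^ r := Real.rpow_pos_of_pos (by linarith) _
  have hB : 0 < (1 - x) ^ r := Real.rpow_pos_of_pos (by linarith) _
  rcases le_or_gt 1 (r * x) with h | h
  · have h1 : (1 - r * x) * (1 + x) ^ r ≤ 0 :=
      mul_nonpos_of_nonpos_of_nonneg (by linarith) hA.le
    have h2 : 0 ≤ (1 + r * x) * (1 - x) ^ r := by positivity
    linarith
  · have hs1 := (Real.hasSum_log_sub_log_of_abs_lt_one
      (show |x| < 1 by rwa [abs_of_nonneg hx0])).mul_left r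
    have hs2 := Real.hasSum_log_sub_log_of_abs_lt_one
      (show |r * x| < 1 by rwa [abs_of_nonneg hrx0])
    have key : r * (Real.log (1 + x) - Real.log (1 - x)) ≤
        Real.log (1 + r * x) - Real.log (1 - r * x) := by
      refine hasSum_le (fun k => ?_) hs1 hs2
      have : r ≤ r ^ (2 * k + 1) := le_self_pow₀ hr (by omega)
      rw [mul_pow, mul_left_comm]
      gcongr
    have hpos1 : 0 < 1 - r * x := by linarith
    have hpos2 : 0 < 1 + r * x := by linarith
    rw [← Real.log_le_log_iff (by positivity) (by positivity),
      Real.log_mul hpos1.ne' hA.ne', Real.log_mul hpos2.ne' hB.ne',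
      Real.log_rpow (by linarith), Real.log_rpow (by linarith)]
    linarith

theorem antitoneOn_two_point_ratio {p : ℝ} (hp : 2 ≤ p) :
    AntitoneOn (fun x : ℝ => ((1 + x) ^ p + (1 - x) ^ p) * (1 + (p - 1) * x ^ 2) ^ (-(p / 2)))
      (Set.Icc 0 1) := by
  have hU (x : ℝ) : 0 < 1 + (p - 1) * x ^ 2 := by
    have : 0 ≤ (p - 1) * x ^ 2 := mul_nonneg (by linarith) (sq_nonneg x)
    linarith
  have hderiv (x : ℝ) : HasDerivAt
      (fun x : ℝ => ((1 + x) ^ p + (1 - x) ^ p) * (1 + (p - 1) * x ^ 2) ^ (-(p / 2)))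
      ((1 * p * (1 + x) ^ (p - 1) + -1 * p * (1 - x) ^ (p - 1)) *
          (1 + (p - 1) * x ^ 2) ^ (-(p / 2)) +
        ((1 + x) ^ p + (1 - x) ^ p) *
          ((p - 1) * (2 * x) * (-(p / 2)) * (1 + (p - 1) * x ^ 2) ^ (-(p / 2) - 1))) x := by
    have h1 : HasDerivAt (fun x : ℝ => 1 + x) 1 x := (hasDerivAt_id x).const_add 1
    have h2 : HasDerivAt (fun x : ℝ => 1 - x) (-1) x := (hasDerivAt_id x).const_sub 1
    have h3 : HasDerivAt (fun x : ℝ => 1 + (p - 1) * x ^ 2) ((p - 1) * (2 * x)) x := by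
      simpa using ((hasDerivAt_pow 2 x).const_mul (p - 1)).const_add 1
    exact ((h1.rpow_const (Or.inr (by linarith))).add
      (h2.rpow_const (Or.inr (by linarith)))).mul (h3.rpow_const (Or.inl (hU x).ne'))
  refine antitoneOn_of_deriv_nonpos (convex_Icc 0 1)
    (fun x _ => (hderiv x).continuousAt.continuousWithinAt)
    (fun x _ => (hderiv x).differentiableAt.differentiableWithinAt) fun x hx => ?_
  rw [interior_Icc] at hx
  obtain ⟨hx0, hx1⟩ := hx
  rw [(hderiv x).deriv]
  have key := one_sub_mul_rpow_le (r := p - 1) (by linarith) hx0.le hx1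
  have e1 : (1 + x) ^ p = (1 + x) * (1 + x) ^ (p - 1) := by
    rw [← Real.rpow_one_add' (by linarith) (by linarith)]; ring_nf
  have e2 : (1 - x) ^ p = (1 - x) * (1 - x) ^ (p - 1) := by
    rw [← Real.rpow_one_add' (by linarith) (by linarith)]; ring_nf
  have e3 : (1 + (p - 1) * x ^ 2) ^ (-(p / 2)) =
      (1 + (p - 1) * x ^ 2) * (1 + (p - 1) * x ^ 2) ^ (-(p / 2) - 1) := by
    rw [Real.rpow_sub_one (hU x).ne']
    field_simp [(hU x).ne']
  have hV : 0 ≤ (1 + (p - 1) * x ^ 2) ^ (-(p / 2) - 1) := Real.rpow_nonneg (hU x).le _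
  rw [e1, e2, e3]
  generalize (1 + (p - 1) * x ^ 2) ^ (-(p / 2) - 1) = V at *
  generalize (1 + x) ^ (p - 1) = A at *
  generalize (1 - x) ^ (p - 1) = B at *
  have : 0 ≤ p * V * ((1 + (p - 1) * x) * B - (1 - (p - 1) * x) * A) :=
    mul_nonneg (mul_nonneg (by linarith) hV) (by linarith)
  linarith

/-- The two-point hypercontractive inequality of Bonami, normalised. -/
theorem one_add_rpow_add_one_sub_rpow_le {p x : ℝ} (hp : 2 ≤ p) (hx0 : 0 ≤ x) (hx1 : x ≤ 1) :
    (1 + x) ^ p + (1 - x) ^ p ≤ 2 * (1 + (p - 1) * x ^ 2) ^ (p / 2) := by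
  have hU : 0 < 1 + (p - 1) * x ^ 2 := by
    have : 0 ≤ (p - 1) * x ^ 2 := mul_nonneg (by linarith) (sq_nonneg x)
    linarith
  have h := antitoneOn_two_point_ratio hp (Set.left_mem_Icc.2 zero_le_one) ⟨hx0, hx1⟩ hx0
  simp only [Real.rpow_neg hU.le] at h
  norm_num at h
  rwa [← div_eq_mul_inv, div_le_iff₀ (Real.rpow_pos_of_pos hU _)] at h

theorem add_rpow_add_sub_rpow_le {p a b : ℝ} (hp : 2 ≤ p) (hb : 0 ≤ b) (hab : b ≤ a) :
    (a + b) ^ p + (a - b) ^ p ≤ 2 * (a ^ 2 + (p - 1) * b ^ 2) ^ (p / 2) := by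
  rcases (hb.trans hab).eq_or_lt with rfl | ha
  · obtain rfl : b = 0 := le_antisymm hab hb
    simp [Real.zero_rpow (show p ≠ 0 by linarith), Real.zero_rpow (show p / 2 ≠ 0 by linarith)]
  · have hx0 : 0 ≤ b / a := by positivity
    have hx1 : b / a ≤ 1 := (div_le_one ha).2 hab
    have e1 : (a + b) ^ p = a ^ p * (1 + b / a) ^ p := by
      rw [← Real.mul_rpow ha.le (by linarith)]
      congr 1
      field_simp
    have e2 : (a - b) ^ p = a ^ p * (1 - b / a) ^ p := by
      rw [← Real.mul_rpow ha.le (by linarith)]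
      congr 1
      field_simp
    have e3 : (a ^ 2 + (p - 1) * b ^ 2) ^ (p / 2) =
        a ^ p * (1 + (p - 1) * (b / a) ^ 2) ^ (p / 2) := by
      have : a ^ p = (a ^ 2) ^ (p / 2) := by
        rw [← Real.rpow_natCast, ← Real.rpow_mul ha.le]
        congr 1
        push_cast
        ring
      rw [this, ← Real.mul_rpow (by positivity)
        (add_nonneg zero_le_one (mul_nonneg (by linarith) (sq_nonneg _)))]
      congr 1
      field_simp
    rw [e1, e2, e3, ← mul_add, mul_left_comm]
    gcongr
    exact one_add_rpow_add_one_sub_rpow_le hp hx0 hx1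

/-- The two-point hypercontractive inequality of Bonami. -/
theorem abs_add_rpow_add_abs_sub_rpow_le {p : ℝ} (hp : 2 ≤ p) (a b : ℝ) :
    |a + b| ^ p + |a - b| ^ p ≤ 2 * (a ^ 2 + (p - 1) * b ^ 2) ^ (p / 2) := by
  have hnonneg {a b : ℝ} (ha : 0 ≤ a) (hb : 0 ≤ b) :
      |a + b| ^ p + |a - b| ^ p ≤ 2 * (a ^ 2 + (p - 1) * b ^ 2) ^ (p / 2) := by
    rw [abs_of_nonneg (add_nonneg ha hb)]
    rcases le_total b a with h | h
    · rw [abs_of_nonneg (sub_nonneg.2 h)]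
      exact add_rpow_add_sub_rpow_le hp hb h
    · rw [abs_sub_comm, abs_of_nonneg (sub_nonneg.2 h), add_comm a b]
      refine (add_rpow_add_sub_rpow_le hp ha h).trans ?_
      have h1 : 0 ≤ (p - 1) * a ^ 2 := mul_nonneg (by linarith) (sq_nonneg a)
      have h2 : a ^ 2 ≤ b ^ 2 := by gcongr
      have h3 : b ^ 2 + (p - 1) * a ^ 2 ≤ a ^ 2 + (p - 1) * b ^ 2 := by nlinarith
      exact mul_le_mul_of_nonneg_left
        (Real.rpow_le_rpow (by positivity) h3 (by linarith)) zero_le_two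
  have h := hnonneg (abs_nonneg a) (abs_nonneg b)
  simp only [sq_abs] at h
  refine le_of_eq_of_le ?_ h
  rcases abs_choice a with ha | ha <;> rcases abs_choice b with hb | hb <;> rw [ha, hb]
  · rw [sub_neg_eq_add, ← sub_eq_add_neg, add_comm]
  · rw [neg_add_eq_sub, abs_sub_comm b a, ← neg_add', abs_neg, add_comm]
  · rw [← neg_add, abs_neg, sub_neg_eq_add, neg_add_eq_sub, abs_sub_comm b a]

/-- `2`-uniform smoothness of `L_p` spaces for `2 ≤ p`, with the optimal constant. -/
theorem PiLp.norm_add_sq_add_norm_sub_sq_le {ι : Type*} [Fintype ι] {p : ENNReal}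
    [Fact (1 ≤ p)] (hp : 2 ≤ p.toReal) (x y : PiLp p (fun _ : ι => ℝ)) :
    ‖x + y‖ ^ 2 + ‖x - y‖ ^ 2 ≤ 2 * ‖x‖ ^ 2 + 2 * (p.toReal - 1) * ‖y‖ ^ 2 := by
  set q := p.toReal with hq
  have hq0 : 0 < q := by linarith
  have hq2 : 1 ≤ q / 2 := by linarith
  have hnorm (z : PiLp p (fun _ : ι => ℝ)) : ‖z‖ = (∑ i, |z i| ^ q) ^ (1 / q) := by
    simpa [Real.norm_eq_abs] using PiLp.norm_eq_sum hq0 z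
  have hnonneg (z : PiLp p (fun _ : ι => ℝ)) : 0 ≤ ∑ i, |z i| ^ q :=
    Finset.sum_nonneg fun i _ => by positivity
  have hpow (z : PiLp p (fun _ : ι => ℝ)) : (‖z‖ ^ 2) ^ (q / 2) = ∑ i, |z i| ^ q := by
    rw [hnorm, ← Real.rpow_natCast, ← Real.rpow_mul (hnonneg z), ← Real.rpow_mul (hnonneg z)]
    convert Real.rpow_one _ using 2
    push_cast
    field_simp
  have hsq (z : PiLp p (fun _ : ι => ℝ)) :
      ‖z‖ ^ 2 = (∑ i, (z i ^ 2) ^ (q / 2)) ^ (1 / (q / 2)) := by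
    have (i : ι) : (z i ^ 2) ^ (q / 2) = |z i| ^ q := by
      rw [← sq_abs, ← Real.rpow_natCast, ← Real.rpow_mul (abs_nonneg _)]
      congr 1
      push_cast
      ring
    simp only [this]
    rw [hnorm, ← Real.rpow_natCast, ← Real.rpow_mul (hnonneg z)]
    congr 1
    push_cast
    field_simp
  have hmean : ((‖x + y‖ ^ 2 + ‖x - y‖ ^ 2) / 2) ^ (q / 2) ≤
      (∑ i, |(x + y) i| ^ q + ∑ i, |(x - y) i| ^ q) / 2 := by
    have := (convexOn_rpow hq2).2 (Set.mem_Ici.2 (sq_nonneg ‖x + y‖))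
      (Set.mem_Ici.2 (sq_nonneg ‖x - y‖)) (by norm_num : (0 : ℝ) ≤ 1 / 2)
      (by norm_num : (0 : ℝ) ≤ 1 / 2) (by norm_num)
    simp only [smul_eq_mul, hpow] at this
    rw [← mul_add, ← mul_add, one_div_mul_eq_div, one_div_mul_eq_div] at this
    exact this
  have hpoint : (∑ i, |(x + y) i| ^ q + ∑ i, |(x - y) i| ^ q) / 2 ≤
      ∑ i, (x i ^ 2 + (q - 1) * y i ^ 2) ^ (q / 2) := by
    rw [← Finset.sum_add_distrib, div_le_iff₀ two_pos, Finset.sum_mul]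
    refine Finset.sum_le_sum fun i _ => ?_
    rw [mul_comm]
    exact abs_add_rpow_add_abs_sub_rpow_le hp (x i) (y i)
  have hmink := Real.Lp_add_le_of_nonneg (Finset.univ : Finset ι) (f := fun i => x i ^ 2)
    (g := fun i => (q - 1) * y i ^ 2) hq2 (fun i _ => sq_nonneg _)
    (fun i _ => mul_nonneg (by linarith) (sq_nonneg _))
  have hscale : (∑ i, ((q - 1) * y i ^ 2) ^ (q / 2)) ^ (1 / (q / 2)) = (q - 1) * ‖y‖ ^ 2 := by
    have hC : 0 ≤ q - 1 := by linarith
    rw [hsq]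
    simp only [Real.mul_rpow hC (sq_nonneg _)]
    rw [← Finset.mul_sum, Real.mul_rpow (by positivity) (by positivity), ← Real.rpow_mul hC,
      mul_one_div_cancel (by linarith), Real.rpow_one]
  rw [hscale, ← hsq x] at hmink
  have hroot := Real.rpow_le_rpow (by positivity) (hmean.trans hpoint)
    (by positivity : 0 ≤ 1 / (q / 2))
  rw [← Real.rpow_mul (by positivity), mul_one_div_cancel (by linarith), Real.rpow_one] at hroot
  linarith

section Smooth

variable {E : Type*} [SeminormedAddCommGroup E] [NormedSpace ℝ E]

/-- In a `2`-uniformly smooth space, adding a centred random vector increases the second moment by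
at most the smoothness constant times the second moment of that vector. -/
theorem sum_mul_norm_add_sq_le {C : ℝ}
    (hE : ∀ x y : E, ‖x + y‖ ^ 2 + ‖x - y‖ ^ 2 ≤ 2 * ‖x‖ ^ 2 + 2 * C * ‖y‖ ^ 2)
    {ι : Type*} {s : Finset ι} {w : ι → ℝ} {Y : ι → E} (hw : ∀ i ∈ s, 0 ≤ w i)
    (hw1 : ∑ i ∈ s, w i = 1) (hY : ∑ i ∈ s, w i • Y i = 0) (a : E) :
    ∑ i ∈ s, w i * ‖a + Y i‖ ^ 2 ≤ ‖a‖ ^ 2 + C * ∑ i ∈ s, w i * ‖Y i‖ ^ 2 := by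
  set G := ∑ i ∈ s, w i * ‖Y i‖ ^ 2 with hG
  have jensen (t : ℝ) : ‖a‖ ^ 2 ≤ ∑ i ∈ s, w i * ‖a - t • Y i‖ ^ 2 := by
    have hmean : ∑ i ∈ s, w i • (a - t • Y i) = a := by
      simp only [smul_sub, Finset.sum_sub_distrib, ← Finset.sum_smul, hw1, smul_comm _ t,
        ← Finset.smul_sum, hY]
      simp
    have := (convexOn_univ_norm (E := E).pow (fun _ _ => norm_nonneg _) 2).map_sum_le hw hw1
      (p := fun i => a - t • Y i) (fun _ _ => Set.mem_univ _)
    simpa [hmean] using this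
  have average {F F' : ι → ℝ} {α β : ℝ} {t : ℝ}
      (h : ∀ i, F i + F' i ≤ α + β * ‖t • Y i‖ ^ 2) :
      ∑ i ∈ s, w i * F i + ∑ i ∈ s, w i * F' i ≤ α + β * t ^ 2 * G := by
    have e : α + β * t ^ 2 * G = ∑ i ∈ s, w i * (α + β * ‖t • Y i‖ ^ 2) := by
      simp only [mul_add, Finset.sum_add_distrib, ← Finset.sum_mul, hw1, hG, Finset.mul_sum,
        norm_smul, mul_pow, Real.norm_eq_abs, sq_abs, one_mul]
      congr 1
      exact Finset.sum_congr rfl fun i _ => by ring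
    rw [e, ← Finset.sum_add_distrib]
    refine Finset.sum_le_sum fun i hi => ?_
    rw [← mul_add]
    exact mul_le_mul_of_nonneg_left (h i) (hw i hi)
  have crude (t : ℝ) :
      ∑ i ∈ s, w i * ‖a + t • Y i‖ ^ 2 - ‖a‖ ^ 2 ≤ 2 * C * t ^ 2 * G := by
    have := average (t := t) fun i => hE a (t • Y i)
    linarith [jensen t]
  have halve (t : ℝ) : ∑ i ∈ s, w i * ‖a + t • Y i‖ ^ 2 - ‖a‖ ^ 2 ≤
      2 * (∑ i ∈ s, w i * ‖a + (t / 2) • Y i‖ ^ 2 - ‖a‖ ^ 2) + C * t ^ 2 * G / 2 := by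
    have h := average (t := t / 2) (α := 0) (β := 2 * C)
      (F := fun i => ‖a + t • Y i‖ ^ 2)
      (F' := fun i => ‖a‖ ^ 2 - 2 * ‖a + (t / 2) • Y i‖ ^ 2) fun i => by
        have := hE (a + (t / 2) • Y i) ((t / 2) • Y i)
        rw [add_assoc, ← add_smul, add_halves, add_sub_cancel_right] at this
        linarith
    simp only [mul_sub, Finset.sum_sub_distrib, ← Finset.sum_mul, hw1, mul_left_comm _ (2 : ℝ),
      ← Finset.mul_sum] at h
    linarith
  have refine_bound (n : ℕ) : ∀ t : ℝ, ∑ i ∈ s, w i * ‖a + t • Y i‖ ^ 2 - ‖a‖ ^ 2 ≤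
      C * t ^ 2 * G * (1 + (1 / 2) ^ n) := by
    induction n with
    | zero => intro t; linarith [crude t]
    | succ n ih =>
      intro t
      rw [pow_succ (1 / 2 : ℝ)]
      linarith [halve t, ih (t / 2)]
  have hlim : Filter.Tendsto (fun n : ℕ => C * G * (1 + (1 / 2 : ℝ) ^ n)) Filter.atTop
      (nhds (C * G * (1 + 0))) :=
    ((tendsto_pow_atTop_nhds_zero_of_lt_one (by norm_num) (by norm_num)).const_add 1).const_mul _
  have := ge_of_tendsto' (b := ∑ i ∈ s, w i * ‖a + Y i‖ ^ 2 - ‖a‖ ^ 2) hlim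
    fun n => by simpa only [one_smul, one_pow, mul_one] using refine_bound n 1
  linarith

/-- Greedy form of Maurey's empirical method in a `2`-uniformly smooth space. -/
theorem exists_norm_sum_sub_sq_le {C R : ℝ} (hC : 0 ≤ C)
    (hE : ∀ x y : E, ‖x + y‖ ^ 2 + ‖x - y‖ ^ 2 ≤ 2 * ‖x‖ ^ 2 + 2 * C * ‖y‖ ^ 2)
    {s : Finset E} {x : E} (hx : x ∈ convexHull ℝ (s : Set E)) (hR : ∀ z ∈ s, ‖z - x‖ ≤ R)
    (k : ℕ) :
    ∃ v : Fin k → E, (∀ t, v t ∈ s) ∧ ‖∑ t, (v t - x)‖ ^ 2 ≤ k * (C * R ^ 2) := by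
  obtain ⟨w, hw, hw1, hwx⟩ := Finset.mem_convexHull'.1 hx
  have hY : ∑ z ∈ s, w z • (z - x) = 0 := by
    simp [smul_sub, Finset.sum_sub_distrib, ← Finset.sum_smul, hw1, hwx]
  have step (a : E) : ∃ z ∈ s, ‖a + (z - x)‖ ^ 2 ≤ ‖a‖ ^ 2 + C * R ^ 2 := by
    by_contra! h
    have hmoment := sum_mul_norm_add_sq_le hE hw hw1 hY a
    have hG : ∑ z ∈ s, w z * ‖z - x‖ ^ 2 ≤ R ^ 2 := by
      calc _ ≤ ∑ z ∈ s, w z * R ^ 2 := Finset.sum_le_sum fun z hz =>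
            mul_le_mul_of_nonneg_left (pow_le_pow_left₀ (norm_nonneg _) (hR z hz) 2) (hw z hz)
        _ = R ^ 2 := by rw [← Finset.sum_mul, hw1, one_mul]
    have hlt : ∑ z ∈ s, w z * (‖a‖ ^ 2 + C * R ^ 2) < ∑ z ∈ s, w z * ‖a + (z - x)‖ ^ 2 := by
      obtain ⟨z, hz, hwz⟩ : ∃ z ∈ s, 0 < w z :=
        Finset.exists_lt_of_sum_lt (by simp [hw1])
      exact Finset.sum_lt_sum (fun z hz => mul_le_mul_of_nonneg_left (h z hz).le (hw z hz))
        ⟨z, hz, mul_lt_mul_of_pos_left (h z hz) hwz⟩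
    rw [← Finset.sum_mul, hw1, one_mul] at hlt
    linarith [mul_le_mul_of_nonneg_left hG hC]
  induction k with
  | zero => exact ⟨Fin.elim0, fun t => t.elim0, by simp⟩
  | succ k ih =>
    obtain ⟨v, hv, hsum⟩ := ih
    obtain ⟨z, hz, hzle⟩ := step (∑ t, (v t - x))
    refine ⟨Fin.snoc v z, fun t => ?_, ?_⟩
    · refine Fin.lastCases ?_ (fun i => ?_) t <;> simp [hz, hv]
    · rw [Fin.sum_univ_castSucc]
      simp only [Fin.snoc_castSucc, Fin.snoc_last]
      push_cast
      linarith

/-- Maurey's empirical method in a `2`-uniformly smooth space. -/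
theorem exists_norm_smul_sum_sub_sq_le {C γ : ℝ} (hC : 0 ≤ C)
    (hE : ∀ x y : E, ‖x + y‖ ^ 2 + ‖x - y‖ ^ 2 ≤ 2 * ‖x‖ ^ 2 + 2 * C * ‖y‖ ^ 2)
    {ι : Type*} [Finite ι] {X : ι → E} (hX : ∀ i, ‖X i‖ ≤ γ) {x : E}
    (hx : x ∈ convexHull ℝ (Set.range X)) {k : ℕ} (hk : 0 < k) :
    ∃ v : Fin k → ι, ‖x - (k : ℝ)⁻¹ • ∑ t, X (v t)‖ ^ 2 ≤ 4 * C * γ ^ 2 / k := by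
  have hxγ : ‖x‖ ≤ γ := by
    have := convexHull_min (t := Metric.closedBall (0 : E) γ)
      (by rintro _ ⟨i, rfl⟩; simpa using hX i) (convex_closedBall 0 γ) hx
    simpa using this
  have hfin := Set.finite_range X
  obtain ⟨u, hu, hsum⟩ := exists_norm_sum_sub_sq_le (R := 2 * γ) hC hE (s := hfin.toFinset)
    (by simpa using hx) (fun z hz => by
      obtain ⟨i, rfl⟩ := hfin.mem_toFinset.1 hz
      linarith [norm_sub_le (X i) x, hX i]) k
  choose v hv using fun t => hfin.mem_toFinset.1 (hu t)
  refine ⟨v, ?_⟩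
  have hk' : (0 : ℝ) < k := by exact_mod_cast hk
  have e : x - (k : ℝ)⁻¹ • ∑ t, X (v t) = -((k : ℝ)⁻¹ • ∑ t, (u t - x)) := by
    simp only [hv, Finset.sum_sub_distrib, Finset.sum_const, Finset.card_univ, Fintype.card_fin,
      ← Nat.cast_smul_eq_nsmul ℝ, smul_sub, smul_smul, inv_mul_cancel₀ hk'.ne', one_smul, neg_sub]
  rw [e, norm_neg, norm_smul, mul_pow, Real.norm_of_nonneg (by positivity)]
  calc ((k : ℝ)⁻¹) ^ 2 * ‖∑ t, (u t - x)‖ ^ 2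
      ≤ ((k : ℝ)⁻¹) ^ 2 * (k * (C * (2 * γ) ^ 2)) := by gcongr
    _ = 4 * C * γ ^ 2 / k := by field_simp; ring

end Smooth

theorem lpNorm_eq_norm_toLp {d : ℕ} {p : ℝ} (hp : 0 < p) (x : Fin d → ℝ) :
    lpNorm p x = ‖WithLp.toLp (ENNReal.ofReal p) x‖ := by
  rw [PiLp.norm_eq_sum (by rwa [ENNReal.toReal_ofReal hp.le]), ENNReal.toReal_ofReal hp.le]
  simp [lpNorm]

/-- Approximate Carathéodory theorem for the `L_p` norm, `2 ≤ p`. -/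
theorem exists_lpNorm_sub_smul_sum_sq_le {d n : ℕ} {X : Fin n → Fin d → ℝ} {p γ : ℝ} (hp : 2 ≤ p)
    (hX : ∀ i, lpNorm p (X i) ≤ γ) {x : Fin d → ℝ} (hx : x ∈ convexHull ℝ (Set.range X)) {k : ℕ}
    (hk : 0 < k) :
    ∃ v : Fin k → Fin n,
      lpNorm p (x - (k : ℝ)⁻¹ • ∑ t, X (v t)) ^ 2 ≤ 4 * (p - 1) * γ ^ 2 / k := by
  have hp0 : 0 < p := by linarith
  have hq : (ENNReal.ofReal p).toReal = p := ENNReal.toReal_ofReal hp0.le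
  have : Fact (1 ≤ ENNReal.ofReal p) := ⟨by rw [ENNReal.one_le_ofReal]; linarith⟩
  let L := (WithLp.linearEquiv (ENNReal.ofReal p) ℝ (Fin d → ℝ)).symm
  have hL (z : Fin d → ℝ) : lpNorm p z = ‖L z‖ := lpNorm_eq_norm_toLp hp0 z
  have hLx : L x ∈ convexHull ℝ (Set.range (L ∘ X)) := by
    rw [Set.range_comp]
    exact (LinearMap.image_convexHull L.toLinearMap (Set.range X)).le ⟨x, hx, rfl⟩
  have hE := PiLp.norm_add_sq_add_norm_sub_sq_le (ι := Fin d) (hp.trans_eq hq.symm)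
  rw [hq] at hE
  obtain ⟨v, hv⟩ := exists_norm_smul_sum_sub_sq_le (by linarith) hE
    (X := L ∘ X) (fun i => (hL (X i)).symm.trans_le (hX i)) hLx hk
  refine ⟨v, ?_⟩
  rw [hL, map_sub, map_smul, map_sum]
  exact hv

/-- Lipschitz optimization over a convex hull can be approximated
by `k`-uniform points for `k ≥ 4λ²pγ²/ε²`. -/
theorem kUniform_approximates_max {d n : ℕ} (X : Fin n → Fin d → ℝ)
    (p : ℝ) (hp : 2 ≤ p)
    (lam γ : ℝ) (hlam : 0 < lam)
    (hγ : IsGreatest (Set.range fun i => lpNorm p (X i)) γ)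
    (f : (Fin d → ℝ) → ℝ)
    (hf : ∀ u ∈ convexHull ℝ (Set.range X), ∀ v ∈ convexHull ℝ (Set.range X),
      |f u - f v| ≤ lam * lpNorm p (u - v))
    (xstar : Fin d → ℝ) (hxstar : xstar ∈ convexHull ℝ (Set.range X))
    (hmax : ∀ z ∈ convexHull ℝ (Set.range X), f z ≤ f xstar)
    (ε : ℝ) (hε : 0 < ε) (k : ℕ) (hk : 0 < k)
    (hkbig : 4 * lam ^ 2 * p * γ ^ 2 / ε ^ 2 ≤ k) :
    ∃ v : Fin k → Fin n,
      (k : ℝ)⁻¹ • ∑ t, X (v t) ∈ convexHull ℝ (Set.range X) ∧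
      |f xstar - f ((k : ℝ)⁻¹ • ∑ t, X (v t))| ≤ ε := by
  have hk' : (0 : ℝ) < k := by exact_mod_cast hk
  obtain ⟨v, hv⟩ := exists_lpNorm_sub_smul_sum_sq_le hp (fun i => hγ.2 ⟨i, rfl⟩) hxstar hk
  have hmem : (k : ℝ)⁻¹ • ∑ t, X (v t) ∈ convexHull ℝ (Set.range X) := by
    rw [Finset.smul_sum]
    exact (convex_convexHull ℝ _).sum_mem (fun _ _ => by positivity) (by simp [hk'.ne'])
      fun t _ => subset_convexHull ℝ _ ⟨v t, rfl⟩
  refine ⟨v, hmem, (hf _ hxstar _ hmem).trans (abs_le_of_sq_le_sq' ?_ hε.le).2⟩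
  rw [div_le_iff₀ (by positivity)] at hkbig
  calc (lam * lpNorm p (xstar - (k : ℝ)⁻¹ • ∑ t, X (v t))) ^ 2
      ≤ lam ^ 2 * (4 * (p - 1) * γ ^ 2 / k) := by rw [mul_pow]; gcongr
    _ ≤ lam ^ 2 * (4 * p * γ ^ 2 / k) := by gcongr; linarith
    _ = 4 * lam ^ 2 * p * γ ^ 2 / k := by ring
    _ ≤ ε ^ 2 := by rw [div_le_iff₀ hk']; linarith
end

section
/- Let 𝔏 be an M-player λ_p-Lipschitz game in which each strategy space S_i is the convex hull of n vectors each of L_p norm at most γ, and suppose 𝔏 possesses an exact equilibrium. Then for every ε > 0 and every positive integer k ≥ 16M²λ²pγ²/ε², there exists a strategy profile x' = (x'_1, …, x'_M) in which every x'_i is a k-uniform point of S_i and which is an ε-equilibrium of 𝔏. -/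
open Finset

/-- The `L_p` norm of a strategy profile, viewed as the concatenated vector in `ℝ^{Md}`. -/
noncomputable def lpNormProd {M d : ℕ} (p : ℝ) (x : Fin M → Fin d → ℝ) : ℝ :=
  (∑ i, ∑ j, |x i j| ^ p) ^ (1 / p)

theorem hasDerivAt_abs_rpow_sub_two_mul_self {p : ℝ} (hp : 2 ≤ p) (x : ℝ) :
    HasDerivAt (fun y : ℝ => |y| ^ (p - 2) * y) ((p - 1) * |x| ^ (p - 2)) x := by
  rcases eq_or_lt_of_le hp with rfl | hp'
  · norm_num
    exact hasDerivAt_id x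
  rcases lt_trichotomy x 0 with hx | rfl | hx
  · have h := ((hasDerivAt_neg x).rpow_const (p := p - 2) (Or.inl (by linarith))).mul
      (hasDerivAt_id x)
    have hE : (fun y : ℝ => |y| ^ (p - 2) * y) =ᶠ[nhds x]
        ((fun y : ℝ => (-y) ^ (p - 2)) * id) := by
      filter_upwards [Iio_mem_nhds hx] with y hy
      simp [abs_of_neg (show y < 0 from hy)]
    refine (h.congr_of_eventuallyEq hE).congr_deriv ?_
    have h1 : (-x) ^ (p - 2) = (-x) ^ (p - 2 - 1) * (-x) := by
      rw [← Real.rpow_add_one (by linarith)]; ring_nf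
    simp only [abs_of_neg hx, id, h1]
    ring
  · rw [hasDerivAt_iff_tendsto_slope]
    have hc : Filter.Tendsto (fun y : ℝ => |y| ^ (p - 2)) (nhdsWithin 0 {0}ᶜ)
        (nhds ((p - 1) * |(0 : ℝ)| ^ (p - 2))) := by
      have : Continuous (fun y : ℝ => |y| ^ (p - 2)) :=
        continuous_abs.rpow_const fun _ => Or.inr (by linarith)
      have h := (this.tendsto 0).mono_left (nhdsWithin_le_nhds (s := {0}ᶜ))
      simpa [Real.zero_rpow (show p - 2 ≠ 0 by linarith)] using h
    refine hc.congr' ?_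
    filter_upwards [self_mem_nhdsWithin] with y hy
    have hy' : y ≠ 0 := hy
    simp [slope_def_field, hy']
  · have h := ((hasDerivAt_id x).rpow_const (p := p - 2) (Or.inl hx.ne')).mul
      (hasDerivAt_id x)
    have hE : (fun y : ℝ => |y| ^ (p - 2) * y) =ᶠ[nhds x]
        ((fun y : ℝ => (id y) ^ (p - 2)) * id) := by
      filter_upwards [Ioi_mem_nhds hx] with y hy
      simp [abs_of_pos (show 0 < y from hy)]
    refine (h.congr_of_eventuallyEq hE).congr_deriv ?_
    have h1 : x ^ (p - 2) = x ^ (p - 2 - 1) * x := by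
      rw [← Real.rpow_add_one hx.ne']; ring_nf
    simp only [abs_of_pos hx, id, h1]
    ring

theorem sum_abs_rpow_sub_two_mul_sq_le {d : ℕ} {p : ℝ} (hp : 2 ≤ p) (a u : Fin d → ℝ) :
    ∑ i, |a i| ^ (p - 2) * u i ^ 2
      ≤ (∑ i, |a i| ^ p) ^ ((p - 2) / p) * (∑ i, |u i| ^ p) ^ (2 / p) := by
  rcases eq_or_lt_of_le hp with rfl | hp'
  · simp
  have hpq : (p / (p - 2)).HolderConjugate (p / 2) := by
    rw [Real.holderConjugate_iff]
    refine ⟨by rw [lt_div_iff₀ (by linarith)]; linarith, ?_⟩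
    have : p - 2 ≠ 0 := by linarith
    field_simp
    ring
  have h := Real.inner_le_Lp_mul_Lq univ (fun i => |a i| ^ (p - 2)) (fun i => u i ^ 2) hpq
  refine h.trans_eq ?_
  congr 1
  · rw [one_div_div]
    congr 1
    refine sum_congr rfl fun i _ => ?_
    have : p - 2 ≠ 0 := by linarith
    rw [abs_of_nonneg (by positivity), ← Real.rpow_mul (abs_nonneg _)]
    congr 1
    field_simp
  · rw [one_div_div]
    congr 1
    refine sum_congr rfl fun i _ => ?_
    rw [abs_of_nonneg (by positivity), ← sq_abs, ← Real.rpow_natCast, ← Real.rpow_mul (abs_nonneg _)]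
    congr 1
    push_cast
    field_simp

theorem le_add_of_second_deriv_le {g g' g'' : ℝ → ℝ} {C : ℝ}
    (hg : ∀ t, HasDerivAt g (g' t) t) (hg' : ∀ t, HasDerivAt g' (g'' t) t)
    (hC : ∀ t, g'' t ≤ 2 * C) (h0 : g' 0 ≤ 0) : g 1 ≤ g 0 + C := by
  have hanti : Antitone fun t => g' t - 2 * C * t := by
    have hd : ∀ t, HasDerivAt (fun t => g' t - 2 * C * t) (g'' t - 2 * C * 1) t := fun t =>
      (hg' t).sub ((hasDerivAt_id t).const_mul _)
    refine antitone_of_deriv_nonpos (fun t => (hd t).differentiableAt) fun t => ?_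
    rw [(hd t).deriv]
    linarith [hC t]
  have hd : ∀ t, HasDerivAt (fun t => g t - C * t ^ 2) (g' t - 2 * C * t) t := fun t => by
    refine ((hg t).sub ((hasDerivAt_pow 2 t).const_mul C)).congr_deriv ?_
    simp
    ring
  have hmono : AntitoneOn (fun t => g t - C * t ^ 2) (Set.Icc 0 1) := by
    refine antitoneOn_of_deriv_nonpos (convex_Icc 0 1)
      (fun t _ => (hd t).continuousAt.continuousWithinAt)
      (fun t _ => (hd t).differentiableAt.differentiableWithinAt) fun t ht => ?_
    rw [interior_Icc] at ht
    rw [(hd t).deriv]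
    have := hanti ht.1.le
    simp only [mul_zero, sub_zero] at this
    linarith
  have := hmono (Set.left_mem_Icc.2 zero_le_one) (Set.right_mem_Icc.2 zero_le_one) zero_le_one
  simp only at this
  linarith

/-- A regularised form of the `2`-uniform smoothness of the `L_p` norm. -/
theorem sum_abs_add_rpow_add_const_le {d : ℕ} {p δ : ℝ} (hp : 2 ≤ p) (hδ : 0 < δ)
    (s u : Fin d → ℝ) (h : ∑ i, |s i| ^ (p - 2) * s i * u i ≤ 0) :
    (∑ i, |s i + u i| ^ p + δ) ^ (2 / p)
      ≤ (∑ i, |s i| ^ p + δ) ^ (2 / p) + (p - 1) * (∑ i, |u i| ^ p) ^ (2 / p) := by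
  set Φ : ℝ → ℝ := fun t => ∑ i, |s i + t * u i| ^ p + δ with hΦ
  set Ψ : ℝ → ℝ := fun t => ∑ i, |s i + t * u i| ^ (p - 2) * (s i + t * u i) * u i with hΨ
  set Θ : ℝ → ℝ := fun t => ∑ i, |s i + t * u i| ^ (p - 2) * u i ^ 2 with hΘ
  have hp0 : 0 < p := by linarith
  have hΦpos : ∀ t, 0 < Φ t := fun t => by positivity
  have hlin : ∀ i t, HasDerivAt (fun t => s i + t * u i) (u i) t := fun i t => by
    simpa using ((hasDerivAt_id t).mul_const (u i)).const_add (s i)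
  have hΦd : ∀ t, HasDerivAt Φ (p * Ψ t) t := fun t => by
    have h1 : HasDerivAt (fun t => ∑ i, |s i + t * u i| ^ p)
        (∑ i, p * |s i + t * u i| ^ (p - 2) * (s i + t * u i) * u i) t :=
      HasDerivAt.fun_sum fun i _ =>
        HasDerivAt.comp (h₂ := fun y : ℝ => |y| ^ p) t
          (hasDerivAt_abs_rpow (s i + t * u i) (by linarith : 1 < p)) (hlin i t)
    refine (h1.add_const δ).congr_deriv ?_
    rw [hΨ, mul_sum]
    exact sum_congr rfl fun i _ => by ring
  have hΨd : ∀ t, HasDerivAt Ψ ((p - 1) * Θ t) t := fun t => by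
    have h1 : HasDerivAt Ψ
        (∑ i, (p - 1) * |s i + t * u i| ^ (p - 2) * u i * u i) t :=
      HasDerivAt.fun_sum fun i _ =>
        ((hasDerivAt_abs_rpow_sub_two_mul_self hp (s i + t * u i)).comp t (hlin i t)).mul_const _
    refine h1.congr_deriv ?_
    rw [hΘ, mul_sum]
    exact sum_congr rfl fun i _ => by ring
  have hg : ∀ t, HasDerivAt (fun t => Φ t ^ (2 / p)) (2 * (Φ t ^ (2 / p - 1) * Ψ t)) t :=
    fun t => by
      refine ((hΦd t).rpow_const (p := 2 / p) (Or.inl (hΦpos t).ne')).congr_deriv ?_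
      field_simp
  have hg' : ∀ t, HasDerivAt (fun t => 2 * (Φ t ^ (2 / p - 1) * Ψ t))
      (2 * (p * Ψ t * (2 / p - 1) * Φ t ^ (2 / p - 1 - 1) * Ψ t
        + Φ t ^ (2 / p - 1) * ((p - 1) * Θ t))) t := fun t =>
    (((hΦd t).rpow_const (p := 2 / p - 1) (Or.inl (hΦpos t).ne')).mul (hΨd t)).const_mul 2
  have hbound : ∀ t, 2 * (p * Ψ t * (2 / p - 1) * Φ t ^ (2 / p - 1 - 1) * Ψ t
        + Φ t ^ (2 / p - 1) * ((p - 1) * Θ t))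
      ≤ 2 * ((p - 1) * (∑ i, |u i| ^ p) ^ (2 / p)) := fun t => by
    have h1 : p * Ψ t * (2 / p - 1) * Φ t ^ (2 / p - 1 - 1) * Ψ t ≤ 0 := by
      have e : p * Ψ t * (2 / p - 1) * Φ t ^ (2 / p - 1 - 1) * Ψ t
          = -((p - 2) * (Φ t ^ (2 / p - 1 - 1) * Ψ t ^ 2)) := by
        field_simp
        ring
      rw [e, neg_nonpos]
      have := hΦpos t
      exact mul_nonneg (by linarith) (by positivity)
    have h2 : Φ t ^ (2 / p - 1) * Θ t ≤ (∑ i, |u i| ^ p) ^ (2 / p) := by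
      have hΘle : Θ t ≤ Φ t ^ ((p - 2) / p) * (∑ i, |u i| ^ p) ^ (2 / p) := by
        refine (sum_abs_rpow_sub_two_mul_sq_le hp (fun i => s i + t * u i) u).trans ?_
        refine mul_le_mul_of_nonneg_right ?_ (by positivity)
        refine Real.rpow_le_rpow (by positivity) ?_ (div_nonneg (by linarith) hp0.le)
        simp only [hΦ]
        linarith
      calc Φ t ^ (2 / p - 1) * Θ t
          ≤ Φ t ^ (2 / p - 1) * (Φ t ^ ((p - 2) / p) * (∑ i, |u i| ^ p) ^ (2 / p)) :=
            mul_le_mul_of_nonneg_left hΘle (Real.rpow_nonneg (hΦpos t).le _)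
        _ = (∑ i, |u i| ^ p) ^ (2 / p) := by
            rw [← mul_assoc, ← Real.rpow_add (hΦpos t)]
            have : 2 / p - 1 + (p - 2) / p = 0 := by field_simp; ring
            rw [this, Real.rpow_zero, one_mul]
    nlinarith [mul_le_mul_of_nonneg_left h2 (by linarith : 0 ≤ p - 1)]
  have h0 : 2 * (Φ 0 ^ (2 / p - 1) * Ψ 0) ≤ 0 := by
    have h1 : Ψ 0 ≤ 0 := by simpa [hΨ] using h
    have := mul_nonpos_of_nonneg_of_nonpos (Real.rpow_nonneg (hΦpos 0).le (2 / p - 1)) h1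
    linarith
  have := le_add_of_second_deriv_le hg hg' hbound h0
  simpa [hΦ] using this

theorem lpNorm_sq {d : ℕ} (p : ℝ) (x : Fin d → ℝ) :
    lpNorm p x ^ 2 = (∑ i, |x i| ^ p) ^ (2 / p) := by
  rw [lpNorm, ← Real.rpow_natCast, ← Real.rpow_mul (by positivity)]
  congr 1
  push_cast
  ring

theorem lpNorm_add_sq_le {d : ℕ} {p : ℝ} (hp : 2 ≤ p) (s u : Fin d → ℝ)
    (h : ∑ i, |s i| ^ (p - 2) * s i * u i ≤ 0) :
    lpNorm p (s + u) ^ 2 ≤ lpNorm p s ^ 2 + (p - 1) * lpNorm p u ^ 2 := by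
  simp only [lpNorm_sq, Pi.add_apply]
  have hlim : ∀ a : ℝ, Filter.Tendsto (fun δ : ℝ => (a + δ) ^ (2 / p)) (nhdsWithin 0 (Set.Ioi 0))
      (nhds (a ^ (2 / p))) := fun a => by
    have hc : Continuous fun δ : ℝ => (a + δ) ^ (2 / p) :=
      (continuous_const.add continuous_id).rpow_const fun _ => Or.inr (by positivity)
    simpa using (hc.tendsto 0).mono_left (nhdsWithin_le_nhds (s := Set.Ioi 0))
  refine le_of_tendsto_of_tendsto (hlim _) ((hlim _).add_const _) ?_
  filter_upwards [self_mem_nhdsWithin] with δ hδ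
  exact sum_abs_add_rpow_add_const_le hp hδ s u h

theorem lpNorm_nonneg {d : ℕ} (p : ℝ) (x : Fin d → ℝ) : 0 ≤ lpNorm p x := by
  unfold lpNorm; positivity

theorem lpNorm_zero {d : ℕ} {p : ℝ} (hp : 0 < p) : lpNorm p (0 : Fin d → ℝ) = 0 := by
  simp [lpNorm, Real.zero_rpow hp.ne', Real.zero_rpow (inv_ne_zero hp.ne')]

theorem lpNorm_smul {d : ℕ} {p : ℝ} (hp : 0 < p) (c : ℝ) (x : Fin d → ℝ) :
    lpNorm p (c • x) = |c| * lpNorm p x := by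
  simp only [lpNorm, Pi.smul_apply, smul_eq_mul, abs_mul,
    Real.mul_rpow (abs_nonneg _) (abs_nonneg _), ← mul_sum]
  rw [Real.mul_rpow (by positivity) (by positivity), ← Real.rpow_mul (abs_nonneg _),
    mul_one_div_cancel hp.ne', Real.rpow_one]

theorem lpNorm_add_le {d : ℕ} {p : ℝ} (hp : 1 ≤ p) (x y : Fin d → ℝ) :
    lpNorm p (x + y) ≤ lpNorm p x + lpNorm p y :=
  Real.Lp_add_le univ x y hp

theorem lpNorm_le_of_mem_convexHull {d : ℕ} {p r : ℝ} (hp : 1 ≤ p) {A : Set (Fin d → ℝ)}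
    (hA : ∀ y ∈ A, lpNorm p y ≤ r) {x : Fin d → ℝ} (hx : x ∈ convexHull ℝ A) :
    lpNorm p x ≤ r := by
  refine convexHull_min (t := {y | lpNorm p y ≤ r}) hA ?_ hx
  intro y hy z hz a b ha hb hab
  have hp0 : 0 < p := by linarith
  simp only [Set.mem_ofPred_eq] at hy hz ⊢
  refine (lpNorm_add_le hp _ _).trans ?_
  rw [lpNorm_smul hp0, lpNorm_smul hp0, abs_of_nonneg ha, abs_of_nonneg hb]
  calc a * lpNorm p y + b * lpNorm p z ≤ a * r + b * r := by gcongr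
    _ = r := by rw [← add_mul, hab, one_mul]

theorem exists_sum_mul_sub_nonpos {n d : ℕ} {Y : Fin n → Fin d → ℝ} {x : Fin d → ℝ}
    (hx : x ∈ convexHull ℝ (Set.range Y)) (w : Fin d → ℝ) :
    ∃ j, ∑ i, w i * (Y j - x) i ≤ 0 := by
  by_contra! hcon
  have hlin : IsLinearMap ℝ fun z : Fin d → ℝ => ∑ i, w i * z i :=
    ⟨fun y z => by simp [mul_add, sum_add_distrib],
      fun c y => by simp [mul_sum, mul_left_comm]⟩
  have hsub : convexHull ℝ (Set.range Y) ⊆ {z | ∑ i, w i * x i < ∑ i, w i * z i} := by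
    refine convexHull_min ?_ (convex_halfSpace_gt hlin _)
    rintro _ ⟨j, rfl⟩
    have := hcon j
    simpa [mul_sub, sum_sub_distrib] using this
  exact lt_irrefl (∑ i, w i * x i) (hsub hx)

/-- An approximate Carathéodory theorem for the `L_p` norm, before rescaling by `1 / k`. -/
theorem exists_lpNorm_sum_sub_sq_le {n d : ℕ} {p γ : ℝ} (hp : 2 ≤ p) {Y : Fin n → Fin d → ℝ}
    (hγ : ∀ j, lpNorm p (Y j) ≤ γ) {x : Fin d → ℝ} (hx : x ∈ convexHull ℝ (Set.range Y)) (k : ℕ) :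
    ∃ v : Fin k → Fin n,
      lpNorm p (∑ t, Y (v t) - (k : ℝ) • x) ^ 2 ≤ k * ((p - 1) * (2 * γ) ^ 2) := by
  induction k with
  | zero => exact ⟨Fin.elim0, by simp [lpNorm_zero (show 0 < p by linarith)]⟩
  | succ k ih =>
    obtain ⟨v, hv⟩ := ih
    set s := ∑ t, Y (v t) - (k : ℝ) • x with hs
    obtain ⟨j, hj⟩ := exists_sum_mul_sub_nonpos hx fun i => |s i| ^ (p - 2) * s i
    refine ⟨Fin.cons j v, ?_⟩
    have e : ∑ t, Y ((Fin.cons j v : Fin (k + 1) → Fin n) t) - ((k + 1 : ℕ) : ℝ) • x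
        = s + (Y j - x) := by
      rw [Fin.sum_univ_succ, hs]
      simp only [Fin.cons_zero, Fin.cons_succ]
      push_cast
      module
    have hxγ : lpNorm p x ≤ γ :=
      lpNorm_le_of_mem_convexHull (by linarith) (by rintro _ ⟨i, rfl⟩; exact hγ i) hx
    have hu : lpNorm p (Y j - x) ≤ 2 * γ := by
      have h1 := lpNorm_add_le (by linarith : 1 ≤ p) (Y j) ((-1 : ℝ) • x)
      rw [lpNorm_smul (by linarith), abs_neg, abs_one, one_mul] at h1
      have e' : Y j - x = Y j + (-1 : ℝ) • x := by module
      rw [e']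
      linarith [hγ j]
    have hu2 : lpNorm p (Y j - x) ^ 2 ≤ (2 * γ) ^ 2 :=
      pow_le_pow_left₀ (lpNorm_nonneg _ _) hu 2
    rw [e]
    have h1 := lpNorm_add_sq_le hp s (Y j - x) hj
    have h2 := mul_le_mul_of_nonneg_left hu2 (by linarith : 0 ≤ p - 1)
    push_cast
    linarith

theorem lpNormProd_le {M d : ℕ} {p c : ℝ} (hp : 1 ≤ p) (hM : 0 < M) {x : Fin M → Fin d → ℝ}
    (hx : ∀ i, lpNorm p (x i) ≤ c) : lpNormProd p x ≤ M * c := by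
  have hp0 : 0 < p := by linarith
  have hc : 0 ≤ c := (lpNorm_nonneg _ _).trans (hx ⟨0, hM⟩)
  have hM1 : (1 : ℝ) ≤ M := by exact_mod_cast hM
  have h1 : ∀ i, ∑ j, |x i j| ^ p ≤ c ^ p := fun i => by
    have h := Real.rpow_le_rpow (lpNorm_nonneg _ _) (hx i) hp0.le
    rwa [lpNorm, ← Real.rpow_mul (by positivity), one_div_mul_cancel hp0.ne', Real.rpow_one] at h
  have h2 : ∑ i, ∑ j, |x i j| ^ p ≤ (M * c) ^ p := by
    calc ∑ i, ∑ j, |x i j| ^ p ≤ ∑ _i : Fin M, c ^ p := sum_le_sum fun i _ => h1 i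
      _ = M * c ^ p := by simp
      _ ≤ (M : ℝ) ^ p * c ^ p := by
        gcongr
        simpa using Real.rpow_le_rpow_of_exponent_le hM1 hp
      _ = (M * c) ^ p := (Real.mul_rpow (by positivity) hc).symm
  calc lpNormProd p x ≤ ((M * c) ^ p) ^ (1 / p) :=
        Real.rpow_le_rpow (by positivity) h2 (by positivity)
    _ = M * c := by
        rw [← Real.rpow_mul (by positivity), mul_one_div_cancel hp0.ne', Real.rpow_one]

/-- An approximate Carathéodory theorem for the `L_p` norm. -/
theorem exists_lpNorm_average_sub_le {n d : ℕ} {p γ c : ℝ} (hp : 2 ≤ p) (hc : 0 ≤ c)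
    {Y : Fin n → Fin d → ℝ} (hγ : ∀ j, lpNorm p (Y j) ≤ γ) {x : Fin d → ℝ}
    (hx : x ∈ convexHull ℝ (Set.range Y)) {k : ℕ} (hk : 0 < k) (hkc : 4 * p * γ ^ 2 ≤ k * c ^ 2) :
    ∃ v : Fin k → Fin n, lpNorm p ((k : ℝ)⁻¹ • ∑ t, Y (v t) - x) ≤ c := by
  obtain ⟨v, hv⟩ := exists_lpNorm_sum_sub_sq_le hp hγ hx k
  refine ⟨v, ?_⟩
  have hk0 : (0 : ℝ) < k := by exact_mod_cast hk
  have e : (k : ℝ)⁻¹ • ∑ t, Y (v t) - x = (k : ℝ)⁻¹ • (∑ t, Y (v t) - (k : ℝ) • x) := by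
    rw [smul_sub, inv_smul_smul₀ hk0.ne']
  rw [e, lpNorm_smul (by linarith), abs_of_pos (by positivity), inv_mul_le_iff₀ hk0]
  refine le_of_sq_le_sq ?_ (by positivity)
  calc _ ≤ _ := hv
    _ ≤ k * (k * c ^ 2) := by
      refine mul_le_mul_of_nonneg_left ?_ hk0.le
      nlinarith [sq_nonneg γ]
    _ = (k * c) ^ 2 := by ring

theorem average_mem_convexHull {n d k : ℕ} (hk : 0 < k) (Y : Fin n → Fin d → ℝ)
    (v : Fin k → Fin n) :
    (k : ℝ)⁻¹ • ∑ t, Y (v t) ∈ convexHull ℝ (Set.range Y) := by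
  have hk0 : (k : ℝ) ≠ 0 := by exact_mod_cast hk.ne'
  rw [smul_sum]
  exact (convex_convexHull ℝ _).sum_mem (fun _ _ => by positivity)
    (by simp [hk0]) fun t _ => subset_convexHull ℝ _ ⟨v t, rfl⟩

/-- a `λ_p`-Lipschitz game possessing an exact equilibrium has a `k`-uniform
`ε`-equilibrium for every `k ≥ 16M²λ²pγ²/ε²`. -/
theorem lipschitz_game_kUniform_approx_equilibrium
    {M n d : ℕ} (p lam γ : ℝ) (hp : 2 ≤ p) (hlam : 0 < lam)
    (Y : Fin M → Fin n → Fin d → ℝ)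
    (S : Fin M → Set (Fin d → ℝ))
    (hS : ∀ i, S i = convexHull ℝ (Set.range (Y i)))
    (hγ : ∀ i j, lpNorm p (Y i j) ≤ γ)
    (T : Fin M → (Fin M → Fin d → ℝ) → ℝ)
    (hT : ∀ i, ∀ x y : Fin M → Fin d → ℝ, (∀ j, x j ∈ S j) → (∀ j, y j ∈ S j) →
      |T i x - T i y| ≤ lam * lpNormProd p (x - y))
    (xstar : Fin M → Fin d → ℝ) (hxstarS : ∀ j, xstar j ∈ S j)
    (heq : ∀ i, ∀ xi ∈ S i, T i (Function.update xstar i xi) ≤ T i xstar)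
    (ε : ℝ) (hε : 0 < ε) (k : ℕ) (hk : 0 < k)
    (hkbig : 16 * (M : ℝ) ^ 2 * lam ^ 2 * p * γ ^ 2 / ε ^ 2 ≤ k) :
    ∃ v : Fin M → Fin k → Fin n,
      ∀ i : Fin M, ∀ xi ∈ S i,
        T i (Function.update (fun j => (k : ℝ)⁻¹ • ∑ t, Y j (v j t)) i xi)
          ≤ T i (fun j => (k : ℝ)⁻¹ • ∑ t, Y j (v j t)) + ε := by
  rcases Nat.eq_zero_or_pos M with rfl | hM
  · exact ⟨fun i => i.elim0, fun i => i.elim0⟩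
  have hM0 : (0 : ℝ) < M := by exact_mod_cast hM
  set c : ℝ := ε / (2 * lam * M) with hc
  have hc0 : 0 < c := by positivity
  have hkc : 4 * p * γ ^ 2 ≤ k * c ^ 2 := by
    rw [div_le_iff₀ (by positivity)] at hkbig
    rw [hc, div_pow, mul_div_assoc', le_div_iff₀ (by positivity)]
    linarith
  have hx : ∀ j, ∃ v : Fin k → Fin n,
      lpNorm p ((k : ℝ)⁻¹ • ∑ t, Y j (v t) - xstar j) ≤ c := fun j =>
    exists_lpNorm_average_sub_le hp hc0.le (hγ j) (hS j ▸ hxstarS j) hk hkc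
  choose v hv using hx
  refine ⟨v, fun i xi hxi => ?_⟩
  set x' : Fin M → Fin d → ℝ := fun j => (k : ℝ)⁻¹ • ∑ t, Y j (v j t) with hx'
  have hx'S : ∀ j, x' j ∈ S j := fun j => hS j ▸ average_mem_convexHull hk (Y j) (v j)
  have hupd : ∀ z : Fin M → Fin d → ℝ, (∀ j, z j ∈ S j) → ∀ j, Function.update z i xi j ∈ S j := by
    intro z hz j
    rcases eq_or_ne j i with rfl | hj
    · simpa using hxi
    · simpa [hj] using hz j
  have hscale : lam * (M * c) = ε / 2 := by
    rw [hc]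
    field_simp
  have hclose : ∀ z z' : Fin M → Fin d → ℝ, (∀ j, z j ∈ S j) → (∀ j, z' j ∈ S j) →
      (∀ j, lpNorm p ((z - z') j) ≤ c) → |T i z - T i z'| ≤ ε / 2 := by
    intro z z' hz hz' h
    rw [← hscale]
    exact (hT i z z' hz hz').trans
      (mul_le_mul_of_nonneg_left (lpNormProd_le (by linarith) hM h) hlam.le)
  have h1 := hclose x' xstar hx'S hxstarS hv
  have h2 := hclose (Function.update x' i xi) (Function.update xstar i xi)
    (hupd _ hx'S) (hupd _ hxstarS) fun j => by
      rcases eq_or_ne j i with rfl | hj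
      · simpa [lpNorm_zero (show 0 < p by linarith)] using hc0.le
      · simpa [hj] using hv j
  have h3 := heq i xi hxi
  rw [abs_le] at h1 h2
  linarith [h1.1, h2.2]
end

section
/- Consider an L₁-biased game with row utility T_r(x, y) = xᵀRy − d_r·‖x − p‖₁, where R has entries in [0,1]. If d_r ≥ 1/2, then the base strategy p is a dominant strategy for the row player: for every y ∈ Δⁿ and every x ∈ Δⁿ, xᵀRy − d_r·‖x − p‖₁ ≤ pᵀRy. -/
open Finset Matrix

/-- Row player's utility in an `L₁`-biased game: `xᵀRy − d_r·‖x − p‖₁`. -/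
noncomputable def TrL1 {n : ℕ} (R : Matrix (Fin n) (Fin n) ℝ) (dr : ℝ) (p : Fin n → ℝ)
    (x y : Fin n → ℝ) : ℝ := x ⬝ᵥ R.mulVec y - dr * ∑ i, |x i - p i|

/-- Pairing with a `[0,1]`-valued vector separates two vectors of equal mass by at most half their
`L₁` distance. -/
theorem dotProduct_sub_dotProduct_le_half_sum_abs_sub {ι : Type*} [Fintype ι] {x p v : ι → ℝ}
    (hxp : ∑ i, x i = ∑ i, p i) (hv : ∀ i, v i ∈ Set.Icc (0 : ℝ) 1) :
    x ⬝ᵥ v - p ⬝ᵥ v ≤ 1 / 2 * ∑ i, |x i - p i| := by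
  have hcenter : x ⬝ᵥ v - p ⬝ᵥ v = ∑ i, (x i - p i) * (v i - 1 / 2) := by
    simp only [dotProduct, mul_sub, sub_mul, Finset.sum_sub_distrib, ← Finset.sum_mul, hxp]
    ring
  rw [hcenter, Finset.mul_sum]
  refine Finset.sum_le_sum fun i _ => ?_
  have hvi : |v i - 1 / 2| ≤ 1 / 2 := abs_le.2 ⟨by linarith [(hv i).1], by linarith [(hv i).2]⟩
  calc (x i - p i) * (v i - 1 / 2) ≤ |x i - p i| * |v i - 1 / 2| :=
        (le_abs_self _).trans_eq (abs_mul _ _)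
    _ ≤ |x i - p i| * (1 / 2) := by gcongr
    _ = 1 / 2 * |x i - p i| := mul_comm _ _

/-- A matrix with entries in `[0,1]` maps the standard simplex into the unit cube. -/
theorem mulVec_mem_Icc_of_mem_stdSimplex {m ι : Type*} [Fintype ι] {R : Matrix m ι ℝ}
    (hR : ∀ i j, R i j ∈ Set.Icc (0 : ℝ) 1) {y : ι → ℝ} (hy : y ∈ stdSimplex ℝ ι) (i : m) :
    R.mulVec y i ∈ Set.Icc (0 : ℝ) 1 := by
  refine ⟨Finset.sum_nonneg fun j _ => mul_nonneg (hR i j).1 (hy.1 j), ?_⟩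
  rw [← hy.2]
  exact Finset.sum_le_sum fun j _ => mul_le_of_le_one_left (hy.1 j) (hR i j).2

/-- in an `L₁`-biased game with `d_r ≥ 1/2`, the base strategy `p` is
dominant for the row player. -/
theorem L1_biased_base_strategy_dominant {n : ℕ}
    (R C : Matrix (Fin n) (Fin n) ℝ)
    (hR : ∀ i j, R i j ∈ Set.Icc (0 : ℝ) 1) (hC : ∀ i j, C i j ∈ Set.Icc (0 : ℝ) 1)
    (p q : Fin n → ℝ) (hp : p ∈ stdSimplex ℝ (Fin n)) (hq : q ∈ stdSimplex ℝ (Fin n))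
    (dr dc : ℝ) (hdc : 0 ≤ dc)
    (hdr : 1 / 2 ≤ dr) :
    ∀ y ∈ stdSimplex ℝ (Fin n), ∀ x ∈ stdSimplex ℝ (Fin n),
      TrL1 R dr p x y ≤ p ⬝ᵥ R.mulVec y := by
  intro y hy x hx
  have hgain := dotProduct_sub_dotProduct_le_half_sum_abs_sub (hx.2.trans hp.2.symm)
    (mulVec_mem_Icc_of_mem_stdSimplex hR hy)
  have hpenalty : 1 / 2 * ∑ i, |x i - p i| ≤ dr * ∑ i, |x i - p i| := by gcongr
  unfold TrL1
  linarith
end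

section
/- Consider an L₁-biased game with utilities T_r(x, y) = xᵀRy − d_r·‖x − p‖₁ and T_c(x, y) = xᵀCy − d_c·‖y − q‖₁, and set d = max{d_r, d_c}. If (x*, y*) is an exact equilibrium of the biased game, then (x*, y*) is a 2d-well-supported Nash equilibrium of the bimatrix game (R, C): for every i with x*_i > 0 one has (Ry*)_i ≥ max_{j ∈ {1,…,n}} (Ry*)_j − 2d, and for every i with y*_i > 0 one has (Cᵀx*)_i ≥ max_{j ∈ {1,…,n}} (Cᵀx*)_j − 2d. -/
open Finset Matrix

/-- Column player's utility in an `L₁`-biased game: `xᵀCy − d_c·‖y − q‖₁`. -/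
noncomputable def TcL1 {n : ℕ} (C : Matrix (Fin n) (Fin n) ℝ) (dc : ℝ) (q : Fin n → ℝ)
    (x y : Fin n → ℝ) : ℝ := x ⬝ᵥ C.mulVec y - dc * ∑ i, |y i - q i|

/-- A maximizer over the simplex of a linear payoff `u` minus an `L₁` penalty of weight `d`
supports only coordinates whose payoff is within `2 * d` of every other one. -/
theorem sub_two_mul_le_of_isMaxOn_stdSimplex {ι : Type*} [Fintype ι]
    {u p x : ι → ℝ} {d : ℝ} (hd : 0 ≤ d) (hx : x ∈ stdSimplex ℝ ι)
    (hmax : IsMaxOn (fun z => z ⬝ᵥ u - d * ∑ k, |z k - p k|) (stdSimplex ℝ ι) x)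
    {i : ι} (hi : 0 < x i) (j : ι) : u j - 2 * d ≤ u i := by
  classical
  have hs (l k : ι) : 0 ≤ (Pi.single l (x i) : ι → ℝ) k := by
    have h : (0 : ι → ℝ) ≤ Pi.single l (x i) := Pi.single_nonneg.2 hi.le
    exact h k
  have hmem : x + Pi.single j (x i) - Pi.single i (x i) ∈ stdSimplex ℝ ι := by
    refine ⟨fun k => ?_, ?_⟩
    · have hk := hx.1 k
      rcases eq_or_ne k i with rfl | hki
      · simpa using hs j k
      · simpa [Pi.single_eq_of_ne hki] using add_nonneg hk (hs j k)
    · simp [Finset.sum_add_distrib, Finset.sum_sub_distrib, hx.2]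
  have hle := isMaxOn_iff.1 hmax _ hmem
  have hnorm : ∑ k, |(x + Pi.single j (x i) - Pi.single i (x i) : ι → ℝ) k - p k|
      ≤ ∑ k, |x k - p k| + 2 * x i := by
    calc _ ≤ ∑ k, (|x k - p k| + (Pi.single j (x i) : ι → ℝ) k
            + (Pi.single i (x i) : ι → ℝ) k) := by
          refine Finset.sum_le_sum fun k _ => ?_
          rw [Pi.sub_apply, Pi.add_apply, abs_le]
          constructor <;>
            linarith [hs j k, hs i k, neg_abs_le (x k - p k), le_abs_self (x k - p k)]
      _ = _ := by
          simp [Finset.sum_add_distrib]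
          ring
  simp only [sub_dotProduct, add_dotProduct, single_dotProduct] at hle
  have hpen := mul_le_mul_of_nonneg_left hnorm hd
  refine le_of_mul_le_mul_left ?_ hi
  linarith

/-- every exact equilibrium of an `L₁`-biased game is a `2d`-well-supported
Nash equilibrium of the underlying bimatrix game `(R, C)`, where `d = max{d_r, d_c}`:
every pure strategy played with positive probability is within `2d` of the best pure payoff. -/
theorem L1_biased_equilibrium_is_2d_WSNE {n : ℕ}
    (R C : Matrix (Fin n) (Fin n) ℝ)
    (hR : ∀ i j, R i j ∈ Set.Icc (0 : ℝ) 1) (hC : ∀ i j, C i j ∈ Set.Icc (0 : ℝ) 1)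
    (p q : Fin n → ℝ) (hp : p ∈ stdSimplex ℝ (Fin n)) (hq : q ∈ stdSimplex ℝ (Fin n))
    (dr dc : ℝ) (hdr : 0 ≤ dr) (hdc : 0 ≤ dc)
    (xstar ystar : Fin n → ℝ)
    (hxstar : xstar ∈ stdSimplex ℝ (Fin n)) (hystar : ystar ∈ stdSimplex ℝ (Fin n))
    (heqr : ∀ x ∈ stdSimplex ℝ (Fin n), TrL1 R dr p x ystar ≤ TrL1 R dr p xstar ystar)
    (heqc : ∀ y ∈ stdSimplex ℝ (Fin n), TcL1 C dc q xstar y ≤ TcL1 C dc q xstar ystar) :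
    (∀ i, 0 < xstar i → ∀ j, R.mulVec ystar j - 2 * max dr dc ≤ R.mulVec ystar i) ∧
    (∀ i, 0 < ystar i → ∀ j, Cᵀ.mulVec xstar j - 2 * max dr dc ≤ Cᵀ.mulVec xstar i) := by
  constructor
  · intro i hi j
    have h := sub_two_mul_le_of_isMaxOn_stdSimplex hdr hxstar (isMaxOn_iff.2 heqr) hi j
    linarith [le_max_left dr dc]
  · intro i hi j
    have hmax : IsMaxOn (fun z => z ⬝ᵥ Cᵀ.mulVec xstar - dc * ∑ k, |z k - q k|)
        (stdSimplex ℝ (Fin n)) ystar := by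
      refine isMaxOn_iff.2 fun y hy => ?_
      have h := heqc y hy
      simp only [TcL1, dotProduct_mulVec, ← mulVec_transpose] at h
      rwa [dotProduct_comm _ y, dotProduct_comm _ ystar] at h
    have h := sub_two_mul_le_of_isMaxOn_stdSimplex hdc hystar hmax hi j
    linarith [le_max_right dr dc]
end

section
/- Consider an L₁-biased game with row utility T_r(x, y) = xᵀRy − d_r·‖x − p‖₁, where R has entries in [0,1]. Let y* ∈ Δⁿ be any strategy of the column player, let x ∈ Δⁿ be a best response of the row player against y* (a maximizer of T_r(·, y*) over Δⁿ), let δ ∈ [0,1], and let x* = δ·p + (1−δ)·x. Then the row player's regret under (x*, y*) is at most δ: for every x̃ ∈ Δⁿ, T_r(x̃, y*) − T_r(x*, y*) ≤ δ. -/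
open Finset Matrix

/-- A bilinear form with entries in `[0,1]` takes values in `[0,1]` on mixed strategies. -/
theorem dotProduct_mulVec_mem_Icc {m n : Type*} [Fintype m] [Fintype n] {R : Matrix m n ℝ}
    (hR : ∀ i j, R i j ∈ Set.Icc (0 : ℝ) 1) {x : m → ℝ} (hx : x ∈ stdSimplex ℝ m)
    {y : n → ℝ} (hy : y ∈ stdSimplex ℝ n) : x ⬝ᵥ R.mulVec y ∈ Set.Icc (0 : ℝ) 1 := by
  have hRy (i : m) : R.mulVec y i ∈ Set.Icc (0 : ℝ) 1 := by
    refine ⟨Finset.sum_nonneg fun j _ => mul_nonneg (hR i j).1 (hy.1 j), ?_⟩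
    rw [← hy.2]
    exact Finset.sum_le_sum fun j _ => mul_le_of_le_one_left (hy.1 j) (hR i j).2
  refine ⟨Finset.sum_nonneg fun i _ => mul_nonneg (hx.1 i) (hRy i).1, ?_⟩
  rw [← hx.2]
  exact Finset.sum_le_sum fun i _ => mul_le_of_le_one_right (hx.1 i) (hRy i).2

/-- Mixing the base strategy into `x` changes the utility affinely in the mixing weight. -/
theorem TrL1_mix {n : ℕ} (R : Matrix (Fin n) (Fin n) ℝ) (dr : ℝ) (p x y : Fin n → ℝ) {δ : ℝ}
    (hδ : δ ≤ 1) :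
    TrL1 R dr p (δ • p + (1 - δ) • x) y = δ * TrL1 R dr p p y + (1 - δ) * TrL1 R dr p x y := by
  have hnorm : ∑ i, |(δ • p + (1 - δ) • x) i - p i| = (1 - δ) * ∑ i, |x i - p i| := by
    rw [Finset.mul_sum]
    refine Finset.sum_congr rfl fun i _ => ?_
    rw [← abs_of_nonneg (sub_nonneg.2 hδ), ← abs_mul, abs_of_nonneg (sub_nonneg.2 hδ)]
    congr 1
    simp only [Pi.add_apply, Pi.smul_apply, smul_eq_mul]
    ring
  simp only [TrL1, hnorm, add_dotProduct, smul_dotProduct, smul_eq_mul, sub_self, abs_zero,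
    Finset.sum_const_zero]
  ring

/-- in an `L₁`-biased game, mixing the base strategy `p` (with weight `δ`) with
a best response `x` against `y*` yields a strategy `x*` under which the row player's regret is
at most `δ`. -/
theorem L1_biased_row_regret_le_delta {n : ℕ}
    (R : Matrix (Fin n) (Fin n) ℝ)
    (hR : ∀ i j, R i j ∈ Set.Icc (0 : ℝ) 1)
    (p : Fin n → ℝ) (hp : p ∈ stdSimplex ℝ (Fin n))
    (dr : ℝ) (hdr : 0 ≤ dr)
    (ystar : Fin n → ℝ) (hystar : ystar ∈ stdSimplex ℝ (Fin n))
    (x : Fin n → ℝ) (hx : x ∈ stdSimplex ℝ (Fin n))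
    (hbest : ∀ z ∈ stdSimplex ℝ (Fin n), TrL1 R dr p z ystar ≤ TrL1 R dr p x ystar)
    (δ : ℝ) (hδ0 : 0 ≤ δ) (hδ1 : δ ≤ 1)
    (xstar : Fin n → ℝ) (hxstar : xstar = δ • p + (1 - δ) • x) :
    ∀ xt ∈ stdSimplex ℝ (Fin n), TrL1 R dr p xt ystar - TrL1 R dr p xstar ystar ≤ δ := by
  intro xt hxt
  have hgap : TrL1 R dr p x ystar - TrL1 R dr p p ystar ≤ 1 := by
    have hx1 := (dotProduct_mulVec_mem_Icc hR hx hystar).2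
    have hp0 := (dotProduct_mulVec_mem_Icc hR hp hystar).1
    have hpen : 0 ≤ dr * ∑ i, |x i - p i| :=
      mul_nonneg hdr (Finset.sum_nonneg fun i _ => abs_nonneg _)
    simp only [TrL1, sub_self, abs_zero, Finset.sum_const_zero]
    linarith
  rw [hxstar, TrL1_mix R dr p x ystar hδ1]
  linarith [hbest xt hxt, mul_le_of_le_one_right hδ0 hgap]
end

section
/- Let C be an n×n matrix with entries in [0,1], let p ∈ Δⁿ, let d_c ≥ 0, let b_c : Δⁿ → [0, ∞) be a penalty function, and define the column player's utility T_c(x, y) = xᵀCy − d_c·b_c(y). Let y* ∈ Δⁿ be a best response of the column player against p (a maximizer of T_c(p, ·) over Δⁿ), let x ∈ Δⁿ be arbitrary, let δ ∈ [0,1], and let x* = δ·p + (1−δ)·x. If d_c·b_c(y*) ≤ 1, then the column player's regret under (x*, y*) is at most 2 − 2δ: for every ỹ ∈ Δⁿ, T_c(x*, ỹ) − T_c(x*, y*) ≤ 2(1−δ). -/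
open Finset Matrix

theorem dotProduct_mem_Icc_of_mem_stdSimplex {ι : Type*} [Fintype ι] {w v : ι → ℝ}
    (hw : w ∈ stdSimplex ℝ ι) (hv : ∀ i, v i ∈ Set.Icc (0 : ℝ) 1) :
    w ⬝ᵥ v ∈ Set.Icc (0 : ℝ) 1 := by
  refine ⟨Finset.sum_nonneg fun i _ => mul_nonneg (hw.1 i) (hv i).1, ?_⟩
  rw [← hw.2]
  exact Finset.sum_le_sum fun i _ => mul_le_of_le_one_right (hw.1 i) (hv i).2

theorem dotProduct_mulVec_mem_Icc_of_mem_stdSimplex {ι κ : Type*} [Fintype ι] [Fintype κ]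
    {C : Matrix ι κ ℝ} (hC : ∀ i j, C i j ∈ Set.Icc (0 : ℝ) 1) {x : ι → ℝ} {y : κ → ℝ}
    (hx : x ∈ stdSimplex ℝ ι) (hy : y ∈ stdSimplex ℝ κ) :
    x ⬝ᵥ C.mulVec y ∈ Set.Icc (0 : ℝ) 1 := by
  refine dotProduct_mem_Icc_of_mem_stdSimplex hx fun i => ?_
  rw [Matrix.mulVec, dotProduct_comm]
  exact dotProduct_mem_Icc_of_mem_stdSimplex hy (hC i)

/-- in a penalty game where the column player's utility is
`T_c(x, y) = xᵀCy − d_c·b_c(y)` with a nonnegative penalty `b_c`, if `y*` is a best response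
against the base strategy `p`, `x* = δ·p + (1−δ)·x`, and `d_c·b_c(y*) ≤ 1`, then the column
player's regret under `(x*, y*)` is at most `2 − 2δ`. -/
theorem penalty_game_column_regret_bound {n : ℕ}
    (C : Matrix (Fin n) (Fin n) ℝ)
    (hC : ∀ i j, C i j ∈ Set.Icc (0 : ℝ) 1)
    (p : Fin n → ℝ) (hp : p ∈ stdSimplex ℝ (Fin n))
    (dc : ℝ) (hdc : 0 ≤ dc)
    (bc : (Fin n → ℝ) → ℝ) (hbc : ∀ y ∈ stdSimplex ℝ (Fin n), 0 ≤ bc y)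
    (ystar : Fin n → ℝ) (hystar : ystar ∈ stdSimplex ℝ (Fin n))
    (hbest : ∀ y ∈ stdSimplex ℝ (Fin n),
      p ⬝ᵥ C.mulVec y - dc * bc y ≤ p ⬝ᵥ C.mulVec ystar - dc * bc ystar)
    (x : Fin n → ℝ) (hx : x ∈ stdSimplex ℝ (Fin n))
    (δ : ℝ) (hδ0 : 0 ≤ δ) (hδ1 : δ ≤ 1)
    (xstar : Fin n → ℝ) (hxstar : xstar = δ • p + (1 - δ) • x)
    (hpen : dc * bc ystar ≤ 1) :
    ∀ yt ∈ stdSimplex ℝ (Fin n),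
      (xstar ⬝ᵥ C.mulVec yt - dc * bc yt) - (xstar ⬝ᵥ C.mulVec ystar - dc * bc ystar)
        ≤ 2 * (1 - δ) := by
  intro yt hyt
  have h_yt := (dotProduct_mulVec_mem_Icc_of_mem_stdSimplex hC hx hyt).2
  have h_ystar := (dotProduct_mulVec_mem_Icc_of_mem_stdSimplex hC hx hystar).1
  have h_bias := mul_nonneg hdc (hbc yt hyt)
  have h_base := mul_le_mul_of_nonneg_left (hbest yt hyt) hδ0
  have h_dev : (x ⬝ᵥ C.mulVec yt - dc * bc yt) - (x ⬝ᵥ C.mulVec ystar - dc * bc ystar) ≤ 2 := by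
    linarith
  have h_mix := mul_le_mul_of_nonneg_left h_dev (sub_nonneg.mpr hδ1)
  simp only [hxstar, add_dotProduct, smul_dotProduct, smul_eq_mul]
  linarith
end

section
/- Let R be an n×n matrix with entries in [0,1], let p ∈ Δⁿ, let y ∈ Δⁿ, and define α_i = (Ry)_i + 2p_i for each i ∈ {1,…,n}. Let x* ∈ Δⁿ be a best response of the row player against y in the L₂²-biased game with d_r = 1, i.e. a maximizer of xᵀRy − ‖x − p‖₂² over x ∈ Δⁿ (equivalently, a maximizer of Σ_i α_i·x_i − Σ_i x_i² over Δⁿ). Then for any two pure strategies k, l with α_k ≥ α_l: if x*_l > 0, then x*_k > 0. -/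
open Finset Matrix

/-- Pairing with the difference of two coordinate vectors evaluates the difference of two
coordinates. -/
theorem sum_single_sub_single_mul {ι : Type*} [Fintype ι] [DecidableEq ι] (k l : ι) (f : ι → ℝ) :
    ∑ i, ((Pi.single k 1 : ι → ℝ) i - (Pi.single l 1 : ι → ℝ) i) * f i = f k - f l := by
  simp [sub_mul, Finset.sum_sub_distrib, Pi.single_apply]

/-- Moving mass `t ≤ x l` from coordinate `l` to coordinate `k` stays in the simplex. -/
theorem add_mul_single_sub_single_mem_stdSimplex {ι : Type*} [Fintype ι] [DecidableEq ι]
    {x : ι → ℝ} (hx : x ∈ stdSimplex ℝ ι) (k l : ι) {t : ℝ} (ht : 0 ≤ t) (htl : t ≤ x l) :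
    (fun i => x i + t * ((Pi.single k 1 : ι → ℝ) i - (Pi.single l 1 : ι → ℝ) i))
      ∈ stdSimplex ℝ ι := by
  refine ⟨fun i => ?_, ?_⟩
  · have hi := hx.1 i
    rcases eq_or_ne i l with rfl | hl <;> rcases eq_or_ne i k with rfl | hk <;>
      simp [*] <;> linarith
  · have h := sum_single_sub_single_mul k l fun _ => 1
    simp only [mul_one, sub_self] at h
    rw [Finset.sum_add_distrib, ← Finset.mul_sum, h, hx.2, mul_zero, add_zero]

/-- in the `L₂²`-biased game with `d_r = 1`, where `α_i = (Ry)_i + 2p_i`, every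
best response `x*` against `y` satisfies: if `α_l ≤ α_k` and `x*_l > 0`, then `x*_k > 0`. -/
theorem L2sq_biased_best_response_support_ordered {n : ℕ}
    (R : Matrix (Fin n) (Fin n) ℝ)
    (hR : ∀ i j, R i j ∈ Set.Icc (0 : ℝ) 1)
    (p y : Fin n → ℝ) (hp : p ∈ stdSimplex ℝ (Fin n)) (hy : y ∈ stdSimplex ℝ (Fin n))
    (xstar : Fin n → ℝ) (hxstar : xstar ∈ stdSimplex ℝ (Fin n))
    (hbest : ∀ x ∈ stdSimplex ℝ (Fin n),
      x ⬝ᵥ R.mulVec y - ∑ i, (x i - p i) ^ 2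
        ≤ xstar ⬝ᵥ R.mulVec y - ∑ i, (xstar i - p i) ^ 2) :
    ∀ k l : Fin n,
      R.mulVec y l + 2 * p l ≤ R.mulVec y k + 2 * p k →
      0 < xstar l → 0 < xstar k := by
  intro k l hkl hl
  by_contra! hk
  have hk0 : xstar k = 0 := le_antisymm hk (hxstar.1 k)
  have hne : l ≠ k := by
    rintro rfl
    linarith
  set d : Fin n → ℝ := fun i => (Pi.single k 1 : Fin n → ℝ) i - (Pi.single l 1 : Fin n → ℝ) i
    with hd
  set t := xstar l / 2 with ht
  have hsum (f : Fin n → ℝ) : ∑ i, d i * f i = f k - f l := sum_single_sub_single_mul k l f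
  have hdk : d k = 1 := by simp [hd, hne.symm]
  have hdl : d l = -1 := by simp [hd, hne]
  have hmem : (fun i => xstar i + t * d i) ∈ stdSimplex ℝ (Fin n) :=
    add_mul_single_sub_single_mem_stdSimplex hxstar k l (by linarith) (by linarith)
  have hle := hbest _ hmem
  have hlin : (fun i => xstar i + t * d i) ⬝ᵥ R.mulVec y
      = xstar ⬝ᵥ R.mulVec y + t * (R.mulVec y k - R.mulVec y l) := by
    rw [← hsum, dotProduct, dotProduct, Finset.mul_sum, ← Finset.sum_add_distrib]
    exact Finset.sum_congr rfl fun i _ => by ring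
  have hquad : ∑ i, (xstar i + t * d i - p i) ^ 2 = ∑ i, (xstar i - p i) ^ 2
      + 2 * t * ((xstar k - p k) - (xstar l - p l)) + t ^ 2 * (d k - d l) := by
    rw [← hsum d, ← hsum fun i => xstar i - p i, Finset.mul_sum, Finset.mul_sum,
      ← Finset.sum_add_distrib, ← Finset.sum_add_distrib]
    exact Finset.sum_congr rfl fun i _ => by ring
  rw [hlin, hquad, hdk, hdl, hk0] at hle
  have htpos : 0 < t := by positivity
  have hxl : xstar l = 2 * t := by rw [ht]; ring
  rw [hxl] at hle
  nlinarith [mul_nonneg htpos.le (sub_nonneg.2 hkl), mul_pos htpos htpos]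
end

section
/- Let x, q ∈ Δⁿ, let C be an n×n matrix with entries in [0,1], define α_i = (Cᵀx)_i + 2q_i for i ∈ {1,…,n}, and assume α_1 ≥ α_2 ≥ ⋯ ≥ α_n. Fix an integer k with 1 ≤ k ≤ n−1 and assume α_{k+1} > 1. For m ∈ {k, k+1}, define the vector y^m ∈ ℝⁿ by y^m_i = (1/2)·(α_i − (Σ_{j=1}^m α_j − 2)/m) for i ≤ m and y^m_i = 0 for i > m, and assume y^k and y^{k+1} both have all coordinates nonnegative (so they are feasible responses, and in particular y^k, y^{k+1} ∈ Δⁿ). Then Σ_i α_i·y^{k+1}_i − Σ_i (y^{k+1}_i)² > Σ_i α_i·y^k_i − Σ_i (y^k_i)²; equivalently, T_c(x, y^{k+1}) > T_c(x, y^k) where T_c(x, y) = xᵀCy − ‖y − q‖₂². -/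
open Finset Matrix

/-- The KKT feasible response with support `{1, …, m}` (0-indexed: indices `i` with `i < m`):
`y_i = (1/2)·(α_i − (Σ_{j<m} α_j − 2)/m)` on the support and `0` elsewhere. -/
noncomputable def feasResp {n : ℕ} (α : Fin n → ℝ) (m : ℕ) : Fin n → ℝ := fun i =>
  if (i : ℕ) < m then
    (α i - ((∑ j ∈ Finset.univ.filter (fun j : Fin n => (j : ℕ) < m), α j) - 2) / m) / 2
  else 0

/-- The utility of a feasible response on `m` indices with payoff sum `S` is
`(∑_{i<m} α_i² - (S - 2)² / m) / 4`. -/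
lemma feasResp_utility {n : ℕ} (α : Fin n → ℝ) {m : ℕ} (hm : 1 ≤ m) (hmn : m ≤ n) :
    ∑ i, α i * feasResp α m i - ∑ i, (feasResp α m i) ^ 2 =
      (∑ i with Fin.val i < m, α i ^ 2 - ((∑ i with Fin.val i < m, α i) - 2) ^ 2 / m) / 4 := by
  set t := ((∑ i with Fin.val i < m, α i) - 2) / m with ht
  have hm0 : (m : ℝ) ≠ 0 := by positivity
  have hcard : #{i : Fin n | (i : ℕ) < m} = m := by simp [Fin.card_filter_val_lt, hmn]
  have hterm : ∀ i, α i * feasResp α m i - (feasResp α m i) ^ 2 =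
      if (i : ℕ) < m then (α i ^ 2 - t ^ 2) / 4 else 0 := by
    intro i
    simp only [feasResp, ← ht]
    split_ifs <;> ring
  rw [← sum_sub_distrib, sum_congr rfl fun i _ => hterm i, ← sum_filter, ← sum_div,
    sum_sub_distrib, sum_const, hcard, nsmul_eq_mul, ht]
  field_simp

lemma sum_filter_val_lt_succ {n k : ℕ} (hk : k < n) (f : Fin n → ℝ) :
    ∑ i with Fin.val i < k + 1, f i = ∑ i with Fin.val i < k, f i + f ⟨k, hk⟩ := by
  have : (univ.filter fun i : Fin n => (i : ℕ) < k + 1) =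
      insert ⟨k, hk⟩ (univ.filter fun i : Fin n => (i : ℕ) < k) := by
    ext i
    simp only [mem_filter, mem_univ, true_and, mem_insert, Fin.ext_iff]
    omega
  rw [this, sum_insert (by simp), add_comm]

lemma transpose_mulVec_le_one {n : ℕ} {x : Fin n → ℝ} (hx : x ∈ stdSimplex ℝ (Fin n))
    {C : Matrix (Fin n) (Fin n) ℝ} (hC : ∀ i j, C i j ≤ 1) (i : Fin n) :
    Cᵀ.mulVec x i ≤ 1 := by
  rw [← hx.2, mulVec, dotProduct]
  exact sum_le_sum fun j _ => mul_le_of_le_one_left (hx.1 j) (hC j i)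

/-- enlarging the support of a feasible response from `k` to `k+1` strictly
increases the column player's utility, provided the `(k+1)`-st payoff `α_{k+1}` exceeds `1`
(here `α_i = (Cᵀx)_i + 2q_i`, with `α` nonincreasing, and both feasible responses are assumed
coordinatewise nonnegative). -/
theorem L2sq_biased_feasible_response_monotone {n : ℕ}
    (x q : Fin n → ℝ)
    (hx : x ∈ stdSimplex ℝ (Fin n)) (hq : q ∈ stdSimplex ℝ (Fin n))
    (C : Matrix (Fin n) (Fin n) ℝ)
    (hC : ∀ i j, C i j ∈ Set.Icc (0 : ℝ) 1)
    (α : Fin n → ℝ) (hα : ∀ i, α i = Cᵀ.mulVec x i + 2 * q i)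
    (hmono : Antitone α)
    (k : ℕ) (hk1 : 1 ≤ k) (hkn : k + 1 ≤ n)
    (hαk : 1 < α ⟨k, by omega⟩)
    (hnnk : ∀ i, 0 ≤ feasResp α k i)
    (hnnk1 : ∀ i, 0 ≤ feasResp α (k + 1) i) :
    ∑ i, α i * feasResp α k i - ∑ i, (feasResp α k i) ^ 2
      < ∑ i, α i * feasResp α (k + 1) i - ∑ i, (feasResp α (k + 1) i) ^ 2 := by
  have hS : ∑ i with Fin.val i < k, α i ≤ k + 2 := by
    have hcard : #{i : Fin n | (i : ℕ) < k} = k := by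
      simp [Fin.card_filter_val_lt, show k ≤ n by omega]
    have hqk : ∑ i with Fin.val i < k, q i ≤ 1 :=
      hq.2 ▸ sum_le_univ_sum_of_nonneg hq.1
    calc ∑ i with Fin.val i < k, α i ≤ ∑ i with Fin.val i < k, (1 + 2 * q i) :=
          sum_le_sum fun i _ => by
            linarith [hα i, transpose_mulVec_le_one hx (fun i j => (hC i j).2) i]
      _ = k + 2 * ∑ i with Fin.val i < k, q i := by
          rw [sum_add_distrib, ← mul_sum, sum_const, hcard, nsmul_one]
      _ ≤ k + 2 := by linarith
  rw [feasResp_utility α hk1 (by omega), feasResp_utility α (by omega) hkn,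
    sum_filter_val_lt_succ hkn, sum_filter_val_lt_succ hkn]
  generalize ∑ i with Fin.val i < k, α i = S at *
  generalize ∑ i with Fin.val i < k, α i ^ 2 = Q
  generalize α ⟨k, _⟩ = a at *
  have hk0 : (0 : ℝ) < k := by exact_mod_cast hk1
  have hgap : 0 < k * a - (S - 2) := by nlinarith
  have hpos : 0 < (k * a - (S - 2)) ^ 2 / (4 * (k * (k + 1))) := by positivity
  rw [← sub_pos]
  convert hpos using 1
  push_cast
  field_simp
  ring
end

section
/- Let x, q ∈ Δⁿ, let C be an n×n matrix with entries in [0,1], and suppose there is a pure strategy k with q_k > 1/2. Then every best response y* of the column player against x in the L₂²-biased game with d_c = 1 — that is, every maximizer of xᵀCy − ‖y − q‖₂² over y ∈ Δⁿ — satisfies y*_k > 0. -/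
open Finset Matrix

/-- The coordinates of `x ᵥ* C` lie in `[0, 1]` if `x` is a probability vector and the entries
of `C` lie in `[0, 1]`. -/
theorem vecMul_mem_Icc_of_mem_stdSimplex {m n : Type*} [Fintype m]
    {x : m → ℝ} (hx : x ∈ stdSimplex ℝ m) {C : Matrix m n ℝ}
    (hC : ∀ i j, C i j ∈ Set.Icc (0 : ℝ) 1) (j : n) :
    (x ᵥ* C) j ∈ Set.Icc (0 : ℝ) 1 := by
  refine ⟨Finset.sum_nonneg fun i _ => mul_nonneg (hx.1 i) (hC i j).1, ?_⟩
  calc ∑ i, x i * C i j ≤ ∑ i, x i :=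
        Finset.sum_le_sum fun i _ => mul_le_of_le_one_right (hx.1 i) (hC i j).2
    _ = 1 := hx.2

/-- Moving mass `ε` from coordinate `j` to coordinate `k` stays in the simplex. -/
theorem transfer_mem_stdSimplex {n : Type*} [Fintype n] [DecidableEq n] {y : n → ℝ}
    (hy : y ∈ stdSimplex ℝ n) {ε : ℝ} {j k : n} (hε : 0 ≤ ε) (hεj : ε ≤ y j) :
    y + ε • (Pi.single k 1 - Pi.single j 1) ∈ stdSimplex ℝ n := by
  refine ⟨fun i => ?_, ?_⟩
  · have hi := hy.1 i
    simp only [Pi.add_apply, Pi.smul_apply, Pi.sub_apply, smul_eq_mul, Pi.single_apply]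
    split_ifs <;> subst_vars <;> linarith
  · simp [Finset.sum_add_distrib, ← Finset.mul_sum, hy.2]

/-- The change of `‖y - q‖²` when mass `ε` moves from coordinate `j` to coordinate `k`. -/
theorem sum_sq_sub_transfer {n : Type*} [Fintype n] [DecidableEq n] (y q : n → ℝ) (ε : ℝ)
    {j k : n} (hjk : j ≠ k) :
    ∑ i, ((y + ε • (Pi.single k 1 - Pi.single j 1) : n → ℝ) i - q i) ^ 2 =
      ∑ i, (y i - q i) ^ 2 + 2 * ε * ((y k - q k) - (y j - q j)) + 2 * ε ^ 2 := by
  have h : ∀ i, ((y + ε • (Pi.single k 1 - Pi.single j 1) : n → ℝ) i - q i) ^ 2 =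
      (y i - q i) ^ 2 + ((if i = k then 2 * ε * (y i - q i) + ε ^ 2 else 0) +
        (if i = j then -2 * ε * (y i - q i) + ε ^ 2 else 0)) := by
    intro i
    simp only [Pi.add_apply, Pi.smul_apply, Pi.sub_apply, smul_eq_mul, Pi.single_apply]
    split_ifs with hk hj
    · exact absurd (hj.symm.trans hk) hjk
    all_goals ring
  simp only [h, Finset.sum_add_distrib, Finset.sum_ite_eq', Finset.mem_univ, if_true]
  ring

/-- in the `L₂²`-biased game with `d_c = 1`, if the base strategy `q` puts more
than probability `1/2` on a pure strategy `k`, then every best response of the column player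
against any `x` plays `k` with positive probability. -/
theorem L2sq_biased_best_response_plays_heavy_coordinate {n : ℕ}
    (x q : Fin n → ℝ)
    (hx : x ∈ stdSimplex ℝ (Fin n)) (hq : q ∈ stdSimplex ℝ (Fin n))
    (C : Matrix (Fin n) (Fin n) ℝ)
    (hC : ∀ i j, C i j ∈ Set.Icc (0 : ℝ) 1)
    (k : Fin n) (hk : 1 / 2 < q k)
    (ystar : Fin n → ℝ) (hystar : ystar ∈ stdSimplex ℝ (Fin n))
    (hbest : ∀ y ∈ stdSimplex ℝ (Fin n),
      x ⬝ᵥ C.mulVec y - ∑ i, (y i - q i) ^ 2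
        ≤ x ⬝ᵥ C.mulVec ystar - ∑ i, (ystar i - q i) ^ 2) :
    0 < ystar k := by
  by_contra hneg
  have hyk : ystar k = 0 := le_antisymm (not_lt.mp hneg) (hystar.1 k)
  obtain ⟨j, hj⟩ : ∃ j, q j < ystar j := by
    by_contra! hle
    have hlt : ∑ i, ystar i < ∑ i, q i :=
      Finset.sum_lt_sum (fun i _ => hle i) ⟨k, Finset.mem_univ k, by linarith⟩
    exact absurd hlt (by rw [hystar.2, hq.2]; exact lt_irrefl 1)
  have hjk : j ≠ k := by
    rintro rfl
    linarith
  have hbest' := hbest _ (transfer_mem_stdSimplex (k := k) hystar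
    (sub_nonneg.mpr hj.le) (sub_le_self _ (hq.1 j)))
  rw [sum_sq_sub_transfer _ _ _ hjk, dotProduct_mulVec, dotProduct_mulVec, dotProduct_add,
    dotProduct_smul, dotProduct_sub, dotProduct_single_one, dotProduct_single_one,
    smul_eq_mul] at hbest'
  have hak := (vecMul_mem_Icc_of_mem_stdSimplex hx hC k).1
  have haj := (vecMul_mem_Icc_of_mem_stdSimplex hx hC j).2
  have hgain : 0 < (ystar j - q j) * ((x ᵥ* C) k - (x ᵥ* C) j + 2 * q k) :=
    mul_pos (by linarith) (by linarith)
  rw [hyk] at hbest'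
  linarith
end

section
/- Let n ≥ 2, let C be an n×n matrix with entries in [0,1], let d_c > 1/2, and let x ∈ Δⁿ be any strategy of the row player. Then in the inner-product penalty game, where the column player's utility against x is T_c(x, y) = xᵀCy − d_c·yᵀy, no pure strategy is a best response: for every j ∈ {1,…,n}, the standard basis vector e_j is not a maximizer of T_c(x, ·) over Δⁿ, i.e. there exists y ∈ Δⁿ with xᵀCy − d_c·yᵀy > xᵀC e_j − d_c. -/
open Finset Matrix

/-- The payoff of a mixed strategy against a pure one lies in `[0, 1]` if all matrix entries do. -/
lemma dotProduct_mulVec_single_mem_Icc {m n : Type*} [Fintype m] [Fintype n] [DecidableEq n]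
    {C : Matrix m n ℝ} (hC : ∀ i j, C i j ∈ Set.Icc (0 : ℝ) 1)
    {x : m → ℝ} (hx : x ∈ stdSimplex ℝ m) (j : n) :
    x ⬝ᵥ C.mulVec (Pi.single j 1) ∈ Set.Icc (0 : ℝ) 1 := by
  rw [Matrix.mulVec_single_one]
  refine ⟨Finset.sum_nonneg fun i _ => mul_nonneg (hx.1 i) (hC i j).1, ?_⟩
  rw [← hx.2]
  exact Finset.sum_le_sum fun i _ => mul_le_of_le_one_right (hx.1 i) (hC i j).2

lemma sum_sq_smul_single_add_smul_single {n : Type*} [Fintype n] [DecidableEq n] {j k : n}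
    (hjk : j ≠ k) (s t : ℝ) :
    ∑ i, (s • Pi.single j (1 : ℝ) + t • Pi.single k (1 : ℝ) : n → ℝ) i ^ 2 = s ^ 2 + t ^ 2 := by
  rw [Fintype.sum_eq_add j k hjk]
  · simp [hjk, hjk.symm]
  · rintro i ⟨hj, hk⟩
    simp [hj, hk]

/-- in an inner-product penalty game with `d_c > 1/2` (and at least two pure
strategies), no pure strategy of the column player is a best response: against any `x` and any
pure strategy `e_j` there is a mixed strategy with strictly larger utility
`xᵀCy − d_c·yᵀy`. -/
theorem inner_product_penalty_no_pure_best_response {n : ℕ} (hn : 2 ≤ n)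
    (C : Matrix (Fin n) (Fin n) ℝ)
    (hC : ∀ i j, C i j ∈ Set.Icc (0 : ℝ) 1)
    (dc : ℝ) (hdc : 1 / 2 < dc)
    (x : Fin n → ℝ) (hx : x ∈ stdSimplex ℝ (Fin n)) :
    ∀ j : Fin n, ∃ y ∈ stdSimplex ℝ (Fin n),
      x ⬝ᵥ C.mulVec (Pi.single j 1) - dc < x ⬝ᵥ C.mulVec y - dc * ∑ i, y i ^ 2 := by
  intro j
  have : Nontrivial (Fin n) := Fin.nontrivial_iff_two_le.mpr hn
  obtain ⟨k, hkj⟩ := exists_ne j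
  have hd : 0 < dc := by linarith
  obtain ⟨t, ht⟩ : ∃ t, t = (2 * dc - 1) / (4 * dc) := ⟨_, rfl⟩
  have htd : 4 * (dc * t) = 2 * dc - 1 := by rw [ht]; field_simp
  have ht0 : 0 < t := by rw [ht]; exact div_pos (by linarith) (by linarith)
  have ht1 : t ≤ 1 := by rw [ht, div_le_one (by linarith)]; linarith
  refine ⟨(1 - t) • Pi.single j 1 + t • Pi.single k 1,
    convex_stdSimplex ℝ (Fin n) (single_mem_stdSimplex ℝ j) (single_mem_stdSimplex ℝ k)
      (by linarith) ht0.le (by ring), ?_⟩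
  rw [sum_sq_smul_single_add_smul_single hkj.symm, Matrix.mulVec_add, Matrix.mulVec_smul,
    Matrix.mulVec_smul, dotProduct_add, dotProduct_smul, dotProduct_smul, smul_eq_mul, smul_eq_mul]
  have hj := (dotProduct_mulVec_single_mem_Icc hC hx j).2
  have hk := (dotProduct_mulVec_single_mem_Icc hC hx k).1
  generalize x ⬝ᵥ C.mulVec (Pi.single j 1) = a at *
  generalize x ⬝ᵥ C.mulVec (Pi.single k 1) = b at *
  have hgain : 0 < t * (b - a + 2 * dc - 2 * (dc * t)) := mul_pos ht0 (by linarith)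
  linarith
end

section
/- Consider an L_∞-biased game with utilities T_r(x, y) = xᵀRy − d_r·‖x − p‖_∞ and T_c(x, y) = xᵀCy − d_c·‖y − q‖_∞, where R, C have entries in [0,1], p, q ∈ Δⁿ, d_r ≥ 0, and 0 ≤ d_c ≤ 1. Let y* ∈ Δⁿ be a best response of the column player against p (a maximizer of T_c(p, ·)), let x ∈ Δⁿ be a best response of the row player against y* (a maximizer of T_r(·, y*)), and let x* = (2/3)·p + (1/3)·x. Then (x*, y*) is a 2/3-equilibrium: T_r(x̃, y*) ≤ T_r(x*, y*) + 2/3 for every x̃ ∈ Δⁿ, and T_c(x*, ỹ) ≤ T_c(x*, y*) + 2/3 for every ỹ ∈ Δⁿ. -/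
open Finset Matrix

/-- The `L_∞` norm of a vector in `ℝ^n`: `max_i |v_i|`. -/
noncomputable def linfNorm {n : ℕ} (v : Fin n → ℝ) : ℝ := ⨆ i, |v i|

/-- Row player's utility in an `L_∞`-biased game: `xᵀRy − d_r·‖x − p‖_∞`. -/
noncomputable def TrLinf {n : ℕ} (R : Matrix (Fin n) (Fin n) ℝ) (dr : ℝ) (p : Fin n → ℝ)
    (x y : Fin n → ℝ) : ℝ := x ⬝ᵥ R.mulVec y - dr * linfNorm (x - p)

/-- Column player's utility in an `L_∞`-biased game: `xᵀCy − d_c·‖y − q‖_∞`. -/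
noncomputable def TcLinf {n : ℕ} (C : Matrix (Fin n) (Fin n) ℝ) (dc : ℝ) (q : Fin n → ℝ)
    (x y : Fin n → ℝ) : ℝ := x ⬝ᵥ C.mulVec y - dc * linfNorm (y - q)

lemma linfNorm_nonneg {n : ℕ} (v : Fin n → ℝ) : 0 ≤ linfNorm v :=
  Real.iSup_nonneg fun _ => abs_nonneg _

lemma linfNorm_smul {n : ℕ} {a : ℝ} (ha : 0 ≤ a) (v : Fin n → ℝ) :
    linfNorm (a • v) = a * linfNorm v := by
  simp only [linfNorm, Pi.smul_apply, smul_eq_mul, abs_mul, abs_of_nonneg ha]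
  exact (Real.mul_iSup_of_nonneg ha _).symm

lemma stdSimplex_apply_mem_Icc {n : ℕ} {x : Fin n → ℝ} (hx : x ∈ stdSimplex ℝ (Fin n))
    (i : Fin n) : x i ∈ Set.Icc (0 : ℝ) 1 :=
  ⟨hx.1 i, hx.2 ▸ Finset.single_le_sum (fun j _ => hx.1 j) (Finset.mem_univ i)⟩

lemma linfNorm_sub_le_one {n : ℕ} {x y : Fin n → ℝ} (hx : x ∈ stdSimplex ℝ (Fin n))
    (hy : y ∈ stdSimplex ℝ (Fin n)) : linfNorm (x - y) ≤ 1 := by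
  refine Real.iSup_le (fun i => ?_) zero_le_one
  obtain ⟨hx0, hx1⟩ := stdSimplex_apply_mem_Icc hx i
  obtain ⟨hy0, hy1⟩ := stdSimplex_apply_mem_Icc hy i
  rw [Pi.sub_apply, abs_le]
  constructor <;> linarith

lemma dotProduct_mem_Icc_of_mem_stdSimplex_s19 {n : ℕ} {x v : Fin n → ℝ}
    (hx : x ∈ stdSimplex ℝ (Fin n)) (hv : ∀ i, v i ∈ Set.Icc (0 : ℝ) 1) :
    x ⬝ᵥ v ∈ Set.Icc (0 : ℝ) 1 := by
  refine ⟨Finset.sum_nonneg fun i _ => mul_nonneg (hx.1 i) (hv i).1, ?_⟩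
  rw [← hx.2]
  exact Finset.sum_le_sum fun i _ => mul_le_of_le_one_right (hx.1 i) (hv i).2

lemma dotProduct_mulVec_mem_Icc_of_mem_stdSimplex_s19 {n : ℕ} {A : Matrix (Fin n) (Fin n) ℝ}
    (hA : ∀ i j, A i j ∈ Set.Icc (0 : ℝ) 1) {x y : Fin n → ℝ}
    (hx : x ∈ stdSimplex ℝ (Fin n)) (hy : y ∈ stdSimplex ℝ (Fin n)) :
    x ⬝ᵥ A.mulVec y ∈ Set.Icc (0 : ℝ) 1 := by
  refine dotProduct_mem_Icc_of_mem_stdSimplex_s19 hx fun i => ?_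
  rw [Matrix.mulVec, dotProduct_comm]
  exact dotProduct_mem_Icc_of_mem_stdSimplex_s19 hy (hA i)

/-- the base algorithm gives a `2/3`-equilibrium in `L_∞`-biased games with
`0 ≤ d_c ≤ 1`: if `y*` is a best response against `p`, `x` a best response against `y*`,
and `x* = (2/3)·p + (1/3)·x`, then `(x*, y*)` is a `2/3`-equilibrium. -/
theorem Linf_biased_two_thirds_equilibrium {n : ℕ}
    (R C : Matrix (Fin n) (Fin n) ℝ)
    (hR : ∀ i j, R i j ∈ Set.Icc (0 : ℝ) 1) (hC : ∀ i j, C i j ∈ Set.Icc (0 : ℝ) 1)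
    (p q : Fin n → ℝ) (hp : p ∈ stdSimplex ℝ (Fin n)) (hq : q ∈ stdSimplex ℝ (Fin n))
    (dr dc : ℝ) (hdr : 0 ≤ dr) (hdc0 : 0 ≤ dc) (hdc1 : dc ≤ 1)
    (ystar : Fin n → ℝ) (hystar : ystar ∈ stdSimplex ℝ (Fin n))
    (hbrc : ∀ y ∈ stdSimplex ℝ (Fin n), TcLinf C dc q p y ≤ TcLinf C dc q p ystar)
    (x : Fin n → ℝ) (hx : x ∈ stdSimplex ℝ (Fin n))
    (hbrr : ∀ z ∈ stdSimplex ℝ (Fin n), TrLinf R dr p z ystar ≤ TrLinf R dr p x ystar)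
    (xstar : Fin n → ℝ) (hxstar : xstar = (2 / 3 : ℝ) • p + (1 / 3 : ℝ) • x) :
    (∀ xt ∈ stdSimplex ℝ (Fin n),
      TrLinf R dr p xt ystar ≤ TrLinf R dr p xstar ystar + 2 / 3) ∧
    (∀ yt ∈ stdSimplex ℝ (Fin n),
      TcLinf C dc q xstar yt ≤ TcLinf C dc q xstar ystar + 2 / 3) := by
  subst hxstar
  constructor
  · intro xt hxt
    have hbest := hbrr xt hxt
    have hsub : (2 / 3 : ℝ) • p + (1 / 3 : ℝ) • x - p = (1 / 3 : ℝ) • (x - p) := by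
      module
    have hRp := (dotProduct_mulVec_mem_Icc_of_mem_stdSimplex_s19 hR hp hystar).1
    have hRx := (dotProduct_mulVec_mem_Icc_of_mem_stdSimplex_s19 hR hx hystar).2
    have hpen := mul_nonneg hdr (linfNorm_nonneg (x - p))
    simp only [TrLinf] at hbest ⊢
    rw [hsub, linfNorm_smul (by norm_num), add_dotProduct, smul_dotProduct, smul_dotProduct,
      smul_eq_mul, smul_eq_mul]
    linarith
  · intro yt hyt
    have hbest := hbrc yt hyt
    have hCt := (dotProduct_mulVec_mem_Icc_of_mem_stdSimplex_s19 hC hx hyt).2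
    have hCs := (dotProduct_mulVec_mem_Icc_of_mem_stdSimplex_s19 hC hx hystar).1
    have hpen_t := mul_nonneg hdc0 (linfNorm_nonneg (yt - q))
    have hpen_s := mul_le_one₀ hdc1 (linfNorm_nonneg (ystar - q)) (linfNorm_sub_le_one hystar hq)
    simp only [TcLinf, add_dotProduct, smul_dotProduct, smul_eq_mul] at hbest ⊢
    linarith
end
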